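/- Let F be a field of characteristic 0 and D a central division algebra of degree m ≥ 2 over F. Then there exist a field extension K/F in which F is algebraically closed and which splits D, a derivation δ on K with field of constants Const(δ) = F, and a differential polynomial f ∈ K[t;δ] of degree m, such that the Petit algebra S_f = K[t;δ]/K[t;δ]f is an infinite-dimensional unital nonassociative algebra over F whose right nucleus Nuc_r(S_f) is isomorphic to D and whose left and middle nuclei both equal K. -/

import Mathlib

open scoped TensorProduct

/-! ## A framework for differential polynomial rings `K[t;δ]` and Petit algebras `S_f`. -/

/-- A derivation on a field `K`: an additive map satisfying the Leibniz rule. -/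
structure Der (K : Type) [Field K] where
  toFun : K → K
  map_add' : ∀ a b : K, toFun (a + b) = toFun a + toFun b
  leibniz' : ∀ a b : K, toFun (a * b) = a * toFun b + toFun a * b

/-- `F` (given as a subfield of `K` via `algebraMap F K`) is precisely the field of
constants `Const(δ) = {a ∈ K | δ(a) = 0}` of the derivation `δ`. -/
def Der.HasConstants {K : Type} [Field K] (δ : Der K) (F : Type) [Field F]
    [Algebra F K] : Prop :=
  ∀ a : K, δ.toFun a = 0 ↔ ∃ c : F, algebraMap F K c = a

/-- The map `V_p(b) = b^p + δ^{p-1}(b)`. -/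
def Der.Vp {K : Type} [Field K] (δ : Der K) (p : ℕ) (b : K) : K :=
  b ^ p + δ.toFun^[p - 1] b

/-- The `e`-fold iterate `V_{p^e}` of `V_p`. -/
def Der.VpIter {K : Type} [Field K] (δ : Der K) (p e : ℕ) : K → K :=
  (δ.Vp p)^[e]

/-- A realization of the differential polynomial ring `R = K[t;δ]`: a ring `R`
together with an embedding `i : K → R` and an element `t` satisfying the
twist relation `t·a = a·t + δ(a)`, such that every element of `R` is *uniquely*
a left `K`-linear combination of the powers `t^n` (witnessed by the coefficient
function `coeff`), and such that `R` admits a right division algorithm. -/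
structure DiffPolyRing (K : Type) [Field K] (δ : Der K) (R : Type) [Ring R] where
  i : K →+* R
  t : R
  coeff : R → (ℕ →₀ K)
  t_mul : ∀ a : K, t * i a = i a * t + i (δ.toFun a)
  repr' : ∀ x : R, x = (coeff x).sum fun n a => i a * t ^ n
  coeff_unique : ∀ (x : R) (c : ℕ →₀ K), x = (c.sum fun n a => i a * t ^ n) → c = coeff x
  rightDiv : ∀ f x : R, f ≠ 0 → ∃! r : R,
    (∃ q : R, x = q * f + r) ∧ (coeff r).support.max < (coeff f).support.max

namespace DiffPolyRing

variable {K : Type} [Field K] {δ : Der K} {R : Type} [Ring R]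

/-- The degree of a differential polynomial, with `deg 0 = ⊥`. -/
def deg (D : DiffPolyRing K δ R) (x : R) : WithBot ℕ := (D.coeff x).support.max

lemma coeff_zero (D : DiffPolyRing K δ R) : D.coeff 0 = 0 :=
  (D.coeff_unique 0 0 (by simp)).symm

lemma deg_zero (D : DiffPolyRing K δ R) : D.deg 0 = ⊥ := by
  simp [deg, D.coeff_zero]

lemma coeff_add (D : DiffPolyRing K δ R) (x y : R) :
    D.coeff (x + y) = D.coeff x + D.coeff y := by
  refine (D.coeff_unique _ _ ?_).symm
  rw [Finsupp.sum_add_index' (by simp) (by intro n a b; rw [map_add, add_mul])]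
  conv_lhs => rw [D.repr' x, D.repr' y]

lemma coeff_neg (D : DiffPolyRing K δ R) (x : R) : D.coeff (-x) = -D.coeff x := by
  have h := D.coeff_add (-x) x
  rw [neg_add_cancel, D.coeff_zero] at h
  exact eq_neg_of_add_eq_zero_left h.symm

lemma deg_neg (D : DiffPolyRing K δ R) (x : R) : D.deg (-x) = D.deg x := by
  simp [deg, D.coeff_neg]

lemma deg_add_lt (D : DiffPolyRing K δ R) {x y : R} {n : WithBot ℕ}
    (hx : D.deg x < n) (hy : D.deg y < n) : D.deg (x + y) < n := by
  have hsub : (D.coeff (x + y)).support ⊆ (D.coeff x).support ∪ (D.coeff y).support := by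
    rw [D.coeff_add]; exact Finsupp.support_add
  calc D.deg (x + y) ≤ ((D.coeff x).support ∪ (D.coeff y).support).max :=
        Finset.max_mono hsub
    _ = max (D.deg x) (D.deg y) := Finset.max_union
    _ < n := max_lt hx hy

lemma coeff_smul (D : DiffPolyRing K δ R) (c : K) (x : R) :
    D.coeff (D.i c * x) = c • D.coeff x := by
  refine (D.coeff_unique _ _ ?_).symm
  rw [Finsupp.sum_smul_index (by simp)]
  conv_lhs => rw [D.repr' x, Finsupp.mul_sum]
  exact Finsupp.sum_congr fun n _ => by rw [← mul_assoc, ← map_mul]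

lemma deg_i_mul_lt (D : DiffPolyRing K δ R) (c : K) {x : R} {n : WithBot ℕ}
    (hx : D.deg x < n) : D.deg (D.i c * x) < n := by
  have hsub : (D.coeff (D.i c * x)).support ⊆ (D.coeff x).support := by
    rw [D.coeff_smul]; exact Finsupp.support_smul
  exact lt_of_le_of_lt (Finset.max_mono hsub) hx

/-- The additive subgroup of `R` consisting of the differential polynomials of
degree `< m`; this is the underlying set of the Petit algebra `S_f` for `deg f = m`. -/
def res (D : DiffPolyRing K δ R) (m : ℕ) : AddSubgroup R where
  carrier := {x | D.deg x < (m : WithBot ℕ)}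
  add_mem' hx hy := D.deg_add_lt hx hy
  zero_mem' := by
    show D.deg 0 < (m : WithBot ℕ)
    rw [D.deg_zero]
    exact bot_lt_iff_ne_bot.2 (by simp)
  neg_mem' {x} hx := by
    show D.deg (-x) < (m : WithBot ℕ)
    rw [D.deg_neg]; exact hx

/-- The underlying set `{g ∈ K[t;δ] | deg g < m}` of the Petit algebra `S_f`
(for `f` of degree `m`), viewed as a subset of `R = K[t;δ]`. -/
def SfSet (D : DiffPolyRing K δ R) (m : ℕ) : Set R := {x | D.deg x < (m : WithBot ℕ)}

/-- The underlying `F`-vector space of the Petit algebra `S_f`, for `f` of degree `m`. -/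
abbrev Rlt (D : DiffPolyRing K δ R) (m : ℕ) : Type := ↥(D.res m)

instance instSMul {F : Type} [Field F] [Algebra F K] (D : DiffPolyRing K δ R) (m : ℕ) :
    SMul F (D.Rlt m) :=
  ⟨fun c x => ⟨D.i (algebraMap F K c) * (x : R), D.deg_i_mul_lt _ x.2⟩⟩

lemma smul_coe {F : Type} [Field F] [Algebra F K] (D : DiffPolyRing K δ R) (m : ℕ)
    (c : F) (x : D.Rlt m) : ((c • x : D.Rlt m) : R) = D.i (algebraMap F K c) * (x : R) := rfl

/-- The `F`-vector space structure of the Petit algebra (where `F ⊆ K` is the field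
of constants): `c • x = i(c)·x`. -/
instance instModule {F : Type} [Field F] [Algebra F K] (D : DiffPolyRing K δ R) (m : ℕ) :
    Module F (D.Rlt m) where
  one_smul x := Subtype.ext <| by rw [smul_coe]; simp
  mul_smul a b x := Subtype.ext <| by rw [smul_coe, smul_coe, smul_coe]; simp [mul_assoc]
  smul_zero a := Subtype.ext <| by rw [smul_coe]; simp
  smul_add a x y := Subtype.ext <| by
    rw [smul_coe]
    push_cast
    rw [smul_coe, smul_coe, mul_add]
  add_smul a b x := Subtype.ext <| by
    push_cast
    rw [smul_coe, smul_coe, smul_coe]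
    simp [add_mul]
  zero_smul x := Subtype.ext <| by rw [smul_coe]; simp

open Classical in
/-- The remainder `mod_r f` of right division by `f`. -/
noncomputable def modr (D : DiffPolyRing K δ R) (f x : R) : R :=
  if h : ∃! r : R, (∃ q : R, x = q * f + r) ∧
      (D.coeff r).support.max < (D.coeff f).support.max then h.choose else 0

/-- The multiplication of the Petit algebra `S_f`: `g ∘ h = g·h mod_r f`. -/
noncomputable def pmul (D : DiffPolyRing K δ R) (f x y : R) : R := D.modr f (x * y)

/-- The left nucleus of the Petit algebra `S_f`, as a subset of `R`. -/
def nucl (D : DiffPolyRing K δ R) (f : R) (m : ℕ) : Set R :=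
  {x ∈ D.SfSet m | ∀ y ∈ D.SfSet m, ∀ z ∈ D.SfSet m,
    D.pmul f (D.pmul f x y) z = D.pmul f x (D.pmul f y z)}

/-- The middle nucleus of the Petit algebra `S_f`, as a subset of `R`. -/
def nucm (D : DiffPolyRing K δ R) (f : R) (m : ℕ) : Set R :=
  {x ∈ D.SfSet m | ∀ y ∈ D.SfSet m, ∀ z ∈ D.SfSet m,
    D.pmul f (D.pmul f y x) z = D.pmul f y (D.pmul f x z)}

/-- The right nucleus of the Petit algebra `S_f`, as a subset of `R`. -/
def nucr (D : DiffPolyRing K δ R) (f : R) (m : ℕ) : Set R :=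
  {x ∈ D.SfSet m | ∀ y ∈ D.SfSet m, ∀ z ∈ D.SfSet m,
    D.pmul f (D.pmul f y z) x = D.pmul f y (D.pmul f z x)}

/-- The nucleus of the Petit algebra `S_f`, as a subset of `R`. -/
def nuc (D : DiffPolyRing K δ R) (f : R) (m : ℕ) : Set R :=
  D.nucl f m ∩ D.nucm f m ∩ D.nucr f m

/-- `f` is irreducible in `K[t;δ]`: it is not a unit and admits no factorization
into two factors of strictly smaller degree. -/
def Irred (D : DiffPolyRing K δ R) (f : R) : Prop :=
  ¬IsUnit f ∧ ¬∃ g h : R, f = g * h ∧ D.deg g < D.deg f ∧ D.deg h < D.deg f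

/-- The Petit algebra `S_f` is a division algebra: it is nonzero, and all left and
right multiplications by nonzero elements are bijective. -/
def IsDivisionPetit (D : DiffPolyRing K δ R) (f : R) (m : ℕ) : Prop :=
  (∃ x ∈ D.SfSet m, x ≠ 0) ∧ ∀ a ∈ D.SfSet m, a ≠ 0 →
    Set.BijOn (fun x => D.pmul f a x) (D.SfSet m) (D.SfSet m) ∧
    Set.BijOn (fun x => D.pmul f x a) (D.SfSet m) (D.SfSet m)

/-- The unital `F`-algebra `B` realizes the right nucleus of the Petit algebra `S_f`:
there is a bijection `B ≃ Nuc_r(S_f)` preserving addition, multiplication and the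
`F`-algebra structure. -/
def RightNucPresents (F : Type) [Field F] [Algebra F K] (D : DiffPolyRing K δ R)
    (f : R) (m : ℕ) (B : Type) [Ring B] [Algebra F B] : Prop :=
  ∃ φ : B ≃ (D.nucr f m),
    (∀ x y : B, ((φ (x + y) : R)) = (φ x : R) + (φ y : R)) ∧
    (∀ x y : B, ((φ (x * y) : R)) = D.pmul f (φ x : R) (φ y : R)) ∧
    (∀ c : F, ((φ (algebraMap F B c) : R)) = D.i (algebraMap F K c))

/-- A subset `S` of an `F`-vector space has dimension `d`: it contains `d` linearly
independent vectors whose span contains `S`. -/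
def SetDim (F : Type) [Field F] {M : Type} [AddCommGroup M] [Module F M]
    (S : Set M) (d : ℕ) : Prop :=
  ∃ s : Finset M, ↑s ⊆ S ∧ s.card = d ∧
    LinearIndependent F (fun x : (s : Set M) => (x : M)) ∧
    S ⊆ (Submodule.span F (s : Set M) : Set M)

/-- `f ∈ K[t;δ]` of degree `m` is an `A`-polynomial (over the field of constants `F`),
via Amitsur's characterization: the right nucleus of `S_f` has dimension `m²` over `F`. -/
def IsAPoly (F : Type) [Field F] [Algebra F K] (D : DiffPolyRing K δ R)
    (f : R) (m : ℕ) : Prop :=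
  SetDim F {x : D.Rlt m | (x : R) ∈ D.nucr f m} (m ^ 2)

/-- `f ∈ R = K[t;δ]` is bounded: there is `f* ≠ 0` such that `Rf* = f*R` is the
largest two-sided ideal of `R` contained in `Rf`. -/
def IsBounded (D : DiffPolyRing K δ R) (f : R) : Prop :=
  ∃ fs : R, fs ≠ 0 ∧
    {x : R | ∃ r, x = r * fs} = {x : R | ∃ r, x = fs * r} ∧
    (∀ x : R, (∃ r, x = r * fs) → ∃ r, x = r * f) ∧
    ∀ J : Set R, (0 : R) ∈ J → (∀ a ∈ J, ∀ b ∈ J, a + b ∈ J) →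
      (∀ r : R, ∀ a ∈ J, r * a ∈ J ∧ a * r ∈ J) →
      (∀ x ∈ J, ∃ r, x = r * f) → ∀ x ∈ J, ∃ r, x = r * fs

/-- `S_f` is a free right module of rank `n` over its right nucleus. -/
def FreeRankOverNucr (D : DiffPolyRing K δ R) (f : R) (m n : ℕ) : Prop :=
  ∃ b : Fin n → R, (∀ j, b j ∈ D.SfSet m) ∧
    ∀ x ∈ D.SfSet m, ∃! c : Fin n → (D.nucr f m),
      x = ∑ j, D.pmul f (b j) ((c j : R))

/-- The Petit algebra `S_f` is unital with unit `1 ∈ K[t;δ]`. -/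
def PetitUnital (D : DiffPolyRing K δ R) (f : R) (m : ℕ) : Prop :=
  (1 : R) ∈ D.SfSet m ∧ ∀ x ∈ D.SfSet m, D.pmul f 1 x = x ∧ D.pmul f x 1 = x

end DiffPolyRing

namespace DiffPolyRing

variable {K : Type} [Field K] {δ : Der K} {R : Type} [Ring R] (D : DiffPolyRing K δ R)

lemma deg_lt_iff {x : R} {n : ℕ} :
    D.deg x < (n : WithBot ℕ) ↔ ∀ j, n ≤ j → D.coeff x j = 0 := by
  constructor
  · intro h j hj
    by_contra hne
    have h1 : (j : WithBot ℕ) ≤ D.deg x := Finset.le_max (Finsupp.mem_support_iff.2 hne)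
    have h2 : (j : WithBot ℕ) < n := h1.trans_lt h
    exact absurd (WithBot.coe_lt_coe.1 h2) (not_lt.2 hj)
  · intro h
    rw [deg]
    refine (Finset.sup_lt_iff (WithBot.bot_lt_coe n)).2 fun j hj => ?_
    refine WithBot.coe_lt_coe.2 (lt_of_not_ge fun hn => ?_)
    exact (Finsupp.mem_support_iff.1 hj) (h j hn)

lemma mem_SfSet {x : R} {n : ℕ} : x ∈ D.SfSet n ↔ ∀ j, n ≤ j → D.coeff x j = 0 :=
  D.deg_lt_iff

lemma coeff_injective : Function.Injective D.coeff := fun x y h => by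
  rw [D.repr' x, D.repr' y, h]

lemma coeff_sub (x y : R) : D.coeff (x - y) = D.coeff x - D.coeff y := by
  rw [sub_eq_add_neg, coeff_add, coeff_neg, sub_eq_add_neg]

lemma coeff_monomial (a : K) (n : ℕ) : D.coeff (D.i a * D.t ^ n) = Finsupp.single n a :=
  (D.coeff_unique _ _ (by simp)).symm

lemma coeff_i (a : K) : D.coeff (D.i a) = Finsupp.single 0 a := by
  simpa using D.coeff_monomial a 0

lemma coeff_t_pow (n : ℕ) : D.coeff (D.t ^ n) = Finsupp.single n 1 := by
  simpa using D.coeff_monomial 1 n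

/-- Additive induction on differential polynomials, along monomials. -/
lemma induction {p : R → Prop} (hadd : ∀ x y, p x → p y → p (x + y))
    (hmon : ∀ a n, p (D.i a * D.t ^ n)) (x : R) : p x := by
  have h0 : p 0 := by simpa using hmon 0 0
  rw [D.repr' x]
  generalize D.coeff x = c
  induction c using Finsupp.induction_linear with
  | zero => simpa using h0
  | add f g hf hg =>
    rw [Finsupp.sum_add_index' (by simp) (by intro n a b; rw [map_add, add_mul])]
    exact hadd _ _ hf hg
  | single n a => simpa using hmon a n

lemma toFun_zero : δ.toFun 0 = 0 := by simpa using δ.map_add' 0 0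

lemma coeff_t_mul (x : R) (n : ℕ) :
    D.coeff (D.t * x) n = δ.toFun (D.coeff x n) + if n = 0 then 0 else D.coeff x (n - 1) := by
  induction x using D.induction with
  | hadd x y hx hy =>
    rw [mul_add, coeff_add, coeff_add, Finsupp.add_apply, Finsupp.add_apply, hx, hy, δ.map_add']
    split_ifs
    · simp
    · rw [Finsupp.add_apply]
      abel
  | hmon a k =>
    rw [← mul_assoc, D.t_mul, add_mul, mul_assoc, ← pow_succ', coeff_add, coeff_monomial,
      coeff_monomial, coeff_monomial]
    simp only [Finsupp.add_apply, Finsupp.single_apply]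
    rcases n with _ | n
    · by_cases hk : k = 0 <;> simp [hk, toFun_zero]
    · by_cases h1 : k = n + 1 <;> by_cases h2 : k = n <;> simp_all [toFun_zero]

lemma coeff_mul_t (x : R) (n : ℕ) : D.coeff (x * D.t) (n + 1) = D.coeff x n := by
  induction x using D.induction with
  | hadd x y hx hy =>
    rw [add_mul, coeff_add, coeff_add, Finsupp.add_apply, Finsupp.add_apply, hx, hy]
  | hmon a k =>
    rw [mul_assoc, ← pow_succ, coeff_monomial, coeff_monomial]
    simp [Finsupp.single_apply]

lemma coeff_mul_t_pow (x : R) (k n : ℕ) : D.coeff (x * D.t ^ k) (n + k) = D.coeff x n := by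
  induction k with
  | zero => simp
  | succ k ih => rw [pow_succ, ← mul_assoc, ← add_assoc, coeff_mul_t, ih]

lemma t_pow_mul_top {x : R} {d : ℕ} (hd : ∀ j, d < j → D.coeff x j = 0) (k : ℕ) :
    D.coeff (D.t ^ k * x) (d + k) = D.coeff x d ∧
      ∀ j, d + k < j → D.coeff (D.t ^ k * x) j = 0 := by
  induction k with
  | zero => simpa using hd
  | succ k ih =>
    rw [pow_succ', mul_assoc]
    refine ⟨?_, fun j hj => ?_⟩
    · rw [coeff_t_mul, ih.2 _ (by omega), toFun_zero, ← ih.1]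
      simp
    · rw [coeff_t_mul, ih.2 _ (by omega), toFun_zero, ih.2 _ (by omega)]
      simp

section Action

variable {V : Type} [AddCommGroup V] [Module K V] (nabla : AddMonoid.End V)

/-- The additive map by which a differential polynomial acts on a differential module. -/
noncomputable def act (x : R) : AddMonoid.End V :=
  (D.coeff x).sum fun n a => Module.toAddMonoidEnd K V a * nabla ^ n

lemma act_add (x y : R) : D.act nabla (x + y) = D.act nabla x + D.act nabla y := by
  rw [act, act, act, coeff_add,
    Finsupp.sum_add_index' (by simp) (by intro n a b; rw [map_add, add_mul])]

lemma act_monomial (a : K) (n : ℕ) : D.act nabla (D.i a * D.t ^ n) =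
    Module.toAddMonoidEnd K V a * nabla ^ n := by
  simp [act, coeff_monomial]

lemma act_i_mul (a : K) (x : R) :
    D.act nabla (D.i a * x) = Module.toAddMonoidEnd K V a * D.act nabla x := by
  induction x using D.induction with
  | hadd x y hx hy => rw [mul_add, act_add, act_add, hx, hy, mul_add]
  | hmon b n => rw [← mul_assoc, ← map_mul, act_monomial, act_monomial, map_mul, mul_assoc]

variable {nabla}

lemma act_t_mul (hn : ∀ (a : K) (v : V), nabla (a • v) = δ.toFun a • v + a • nabla v)
    (x : R) : D.act nabla (D.t * x) = nabla * D.act nabla x := by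
  induction x using D.induction with
  | hadd x y hx hy => rw [mul_add, act_add, act_add, hx, hy, mul_add]
  | hmon b n =>
    rw [← mul_assoc, D.t_mul, add_mul, mul_assoc, ← pow_succ', act_add, act_monomial,
      act_monomial, act_monomial]
    ext v
    rw [pow_succ']
    exact (add_comm _ _).trans (hn b ((nabla ^ n) v)).symm

lemma act_mul (hn : ∀ (a : K) (v : V), nabla (a • v) = δ.toFun a • v + a • nabla v)
    (x y : R) : D.act nabla (x * y) = D.act nabla x * D.act nabla y := by
  induction x using D.induction with
  | hadd x z hx hz => rw [add_mul, act_add, act_add, hx, hz, add_mul]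
  | hmon a n =>
    rw [mul_assoc, act_i_mul, act_i_mul, mul_assoc]
    congr 1
    induction n with
    | zero =>
      have h1 : D.act nabla (1 : R) = 1 := by simpa using D.act_monomial nabla 1 0
      simp [h1]
    | succ n ih => rw [pow_succ', mul_assoc, D.act_t_mul hn, ih, D.act_t_mul hn, mul_assoc]

lemma act_i_mul_apply (a : K) (x : R) (v : V) :
    D.act nabla (D.i a * x) v = a • D.act nabla x v := by
  rw [act_i_mul]; rfl

lemma act_mul_apply (hn : ∀ (a : K) (v : V), nabla (a • v) = δ.toFun a • v + a • nabla v)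
    (x y : R) (v : V) : D.act nabla (x * y) v = D.act nabla x (D.act nabla y v) := by
  rw [D.act_mul hn]; rfl

lemma act_comm {T : V →ₗ[K] V} (hT : ∀ v, T (nabla v) = nabla (T v)) (x : R) (v : V) :
    D.act nabla x (T v) = T (D.act nabla x v) := by
  induction x using D.induction with
  | hadd x z hx hz =>
    rw [act_add]
    exact (congrArg₂ (· + ·) hx hz).trans (map_add T _ _).symm
  | hmon a n =>
    have h : ∀ (n : ℕ) (v : V), (nabla ^ n) (T v)
        = T ((nabla ^ n) v) := by
      intro n
      induction n with
      | zero => intro v; rfl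
      | succ n ih =>
        intro v
        rw [pow_succ]
        exact (congrArg (nabla ^ n) (hT v).symm).trans (ih _)
    rw [act_monomial]
    exact (congrArg (a • ·) (h n v)).trans (T.map_smul a _).symm

end Action

section Division

variable {D} {f : R} {m : ℕ}

lemma deg_eq_iff : D.deg f = (m : WithBot ℕ) ↔ D.coeff f m ≠ 0 ∧ ∀ j, m < j → D.coeff f j = 0 := by
  constructor
  · intro h
    refine ⟨Finsupp.mem_support_iff.1 (Finset.mem_of_max h), fun j hj => ?_⟩
    refine (D.deg_lt_iff (n := m + 1)).1 ?_ j hj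
    rw [h]
    exact WithBot.coe_lt_coe.2 (Nat.lt_succ_self m)
  · rintro ⟨h1, h2⟩
    refine le_antisymm ?_ (Finset.le_max (Finsupp.mem_support_iff.2 h1))
    refine Finset.max_le fun j hj => WithBot.coe_le_coe.2 (le_of_not_gt fun hm => ?_)
    exact (Finsupp.mem_support_iff.1 hj) (h2 j hm)

lemma ne_zero_of_deg (hf : D.deg f = (m : WithBot ℕ)) : f ≠ 0 := by
  rintro rfl
  rw [D.deg_zero] at hf
  exact WithBot.bot_ne_coe hf

lemma modr_spec (hf : D.deg f = (m : WithBot ℕ)) (x : R) :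
    (∃ q, x = q * f + D.modr f x) ∧ D.modr f x ∈ D.SfSet m := by
  have h := D.rightDiv f x (ne_zero_of_deg hf)
  rw [modr, dif_pos h]
  refine ⟨h.choose_spec.1.1, ?_⟩
  have := h.choose_spec.1.2
  show D.deg _ < _
  rw [← hf]
  exact this

lemma modr_eq (hf : D.deg f = (m : WithBot ℕ)) {x q r : R} (hx : x = q * f + r)
    (hr : r ∈ D.SfSet m) : D.modr f x = r := by
  obtain ⟨h1, h2⟩ := modr_spec hf x
  refine (D.rightDiv f x (ne_zero_of_deg hf)).unique ⟨h1, ?_⟩ ⟨⟨q, hx⟩, ?_⟩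
  · have : D.deg _ < _ := h2
    rwa [← hf] at this
  · have : D.deg _ < _ := hr
    rwa [← hf] at this

lemma modr_of_mem (hf : D.deg f = (m : WithBot ℕ)) {x : R} (hx : x ∈ D.SfSet m) :
    D.modr f x = x := modr_eq hf (q := 0) (by simp) hx

lemma modr_add_mul (hf : D.deg f = (m : WithBot ℕ)) (q x : R) :
    D.modr f (q * f + x) = D.modr f x := by
  obtain ⟨⟨p, hp⟩, h⟩ := modr_spec hf x
  refine modr_eq hf (q := q + p) ?_ h
  conv_lhs => rw [hp]
  rw [add_mul, add_assoc]

lemma modr_eq_modr_iff (hf : D.deg f = (m : WithBot ℕ)) {x y : R} :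
    D.modr f x = D.modr f y ↔ ∃ q, x - y = q * f := by
  obtain ⟨⟨p, hp⟩, -⟩ := modr_spec hf x
  obtain ⟨⟨p', hp'⟩, -⟩ := modr_spec hf y
  constructor
  · intro h
    refine ⟨p - p', ?_⟩
    rw [hp, hp', h, sub_mul]
    simp
  · rintro ⟨q, hq⟩
    rw [sub_eq_iff_eq_add.1 hq, modr_add_mul hf]

lemma modr_mul_modr (hf : D.deg f = (m : WithBot ℕ)) (x y : R) :
    D.modr f (x * D.modr f y) = D.modr f (x * y) := by
  obtain ⟨⟨q, hq⟩, -⟩ := modr_spec hf y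
  refine ((modr_eq_modr_iff hf).2 ⟨x * q, ?_⟩).symm
  rw [← mul_sub, sub_eq_iff_eq_add.2 hq, mul_assoc]

lemma pmul_assoc_iff (hf : D.deg f = (m : WithBot ℕ)) {x y z q r : R} (hxy : x * y = q * f + r)
    (hr : r ∈ D.SfSet m) :
    D.pmul f (D.pmul f x y) z = D.pmul f x (D.pmul f y z) ↔ ∃ p, q * f * z = p * f := by
  rw [pmul, pmul, pmul, pmul, modr_mul_modr hf, modr_eq hf hxy hr, ← mul_assoc, hxy,
    modr_eq_modr_iff hf]
  constructor
  · rintro ⟨p, hp⟩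
    exact ⟨-p, by rw [neg_mul, ← hp, add_mul]; abel⟩
  · rintro ⟨p, hp⟩
    exact ⟨-p, by rw [neg_mul, ← hp, add_mul]; abel⟩

lemma i_mem (hm : 0 < m) (a : K) : D.i a ∈ D.SfSet m := by
  rw [mem_SfSet, coeff_i]
  intro j hj
  rw [Finsupp.single_eq_of_ne (by omega)]

lemma t_pow_mem {n : ℕ} (hm : n < m) : D.t ^ n ∈ D.SfSet m := by
  rw [mem_SfSet, coeff_t_pow]
  intro j hj
  rw [Finsupp.single_eq_of_ne (by omega)]

lemma petitUnital (hf : D.deg f = (m : WithBot ℕ)) (hm : 0 < m) : D.PetitUnital f m := by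
  refine ⟨by simpa using D.i_mem hm (1 : K), fun x hx => ?_⟩
  rw [pmul, pmul, one_mul, mul_one, modr_of_mem hf hx]
  exact ⟨rfl, rfl⟩

/-- If a product of two residues has degree exactly `m` and associates with all third factors,
then `f * z` is a left multiple of `f` for every residue `z`. -/
lemma exists_mul_of_top (hf : D.deg f = (m : WithBot ℕ)) {x y z : R}
    (h1 : D.coeff (x * y) m ≠ 0) (h2 : ∀ j, m < j → D.coeff (x * y) j = 0)
    (h : D.pmul f (D.pmul f x y) z = D.pmul f x (D.pmul f y z)) : ∃ p, f * z = p * f := by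
  obtain ⟨hf1, hf2⟩ := deg_eq_iff.1 hf
  set c : K := D.coeff (x * y) m / D.coeff f m with hc
  have hc0 : c ≠ 0 := div_ne_zero h1 hf1
  have hr : x * y - D.i c * f ∈ D.SfSet m := by
    rw [mem_SfSet]
    intro j hj
    rw [coeff_sub, coeff_smul, Finsupp.sub_apply, Finsupp.smul_apply]
    rcases hj.eq_or_lt with rfl | hj
    · rw [hc, smul_eq_mul, div_mul_cancel₀ _ hf1, sub_self]
    · rw [h2 j hj, hf2 j hj, smul_zero, sub_zero]
  obtain ⟨p, hp⟩ := (pmul_assoc_iff hf (add_sub_cancel (D.i c * f) (x * y)).symm hr).1 h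
  refine ⟨D.i c⁻¹ * p, ?_⟩
  rw [mul_assoc (D.i c⁻¹), ← hp, mul_assoc, ← mul_assoc, ← map_mul, inv_mul_cancel₀ hc0, map_one,
    one_mul]

lemma mem_nucr_iff (hf : D.deg f = (m : WithBot ℕ)) (hm : 2 ≤ m) {z : R} :
    z ∈ D.nucr f m ↔ z ∈ D.SfSet m ∧ ∃ p, f * z = p * f := by
  constructor
  · rintro ⟨hz, h⟩
    refine ⟨hz, exists_mul_of_top hf (x := D.t) (y := D.t ^ (m - 1)) ?_ ?_
      (h _ (by simpa using D.t_pow_mem (n := 1) (by omega)) _ (D.t_pow_mem (by omega)))⟩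
    all_goals rw [← pow_succ', Nat.sub_add_cancel (by omega), coeff_t_pow]
    · simp
    · intro j hj
      rw [Finsupp.single_eq_of_ne (by omega)]
  · rintro ⟨hz, p, hp⟩
    refine ⟨hz, fun x _ y _ => ?_⟩
    obtain ⟨⟨q, hq⟩, hr⟩ := modr_spec hf (x * y)
    exact (pmul_assoc_iff hf hq hr).2 ⟨q * p, by rw [mul_assoc, hp, mul_assoc]⟩

lemma exists_top {x : R} (hx : x ∈ D.SfSet m) (hxi : x ∉ Set.range D.i) :
    ∃ d, 0 < d ∧ d < m ∧ D.coeff x d ≠ 0 ∧ ∀ j, d < j → D.coeff x j = 0 := by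
  rw [mem_SfSet] at hx
  have hne : (D.coeff x).support.Nonempty := by
    rw [Finset.nonempty_iff_ne_empty, ne_eq, Finsupp.support_eq_empty]
    intro h
    exact hxi ⟨0, D.coeff_injective (by rw [h, map_zero, D.coeff_zero])⟩
  set d := (D.coeff x).support.max' hne
  have hd : D.coeff x d ≠ 0 := Finsupp.mem_support_iff.1 (Finset.max'_mem _ hne)
  have htop : ∀ j, d < j → D.coeff x j = 0 := fun j hj => by
    by_contra h
    exact absurd (Finset.le_max' _ j (Finsupp.mem_support_iff.2 h)) (not_le.2 hj)
  refine ⟨d, Nat.pos_of_ne_zero fun h0 => ?_, lt_of_not_ge fun h => hd (hx d h), hd, htop⟩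
  refine hxi ⟨D.coeff x 0, D.coeff_injective ?_⟩
  rw [coeff_i]
  ext j
  rcases Nat.eq_zero_or_pos j with rfl | hj
  · simp
  · rw [Finsupp.single_eq_of_ne (by omega), htop j (by omega)]

/-- **Petit**: if `Nuc_r(S_f) ≠ S_f` then the left nucleus of `S_f` is `K`. -/
lemma nucl_eq (hf : D.deg f = (m : WithBot ℕ)) (hm : 2 ≤ m) (hne : ¬D.SfSet m ⊆ D.nucr f m) :
    D.nucl f m = Set.range D.i := by
  refine Set.Subset.antisymm (fun x hx => ?_) ?_
  · by_contra hxi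
    obtain ⟨d, hd0, hdm, hd, htop⟩ := exists_top hx.1 hxi
    refine hne fun z hz => (mem_nucr_iff hf hm).2 ⟨hz, ?_⟩
    refine exists_mul_of_top hf (x := x) (y := D.t ^ (m - d)) ?_ ?_
      (hx.2 _ (D.t_pow_mem (by omega)) _ hz)
    · rwa [show m = d + (m - d) by omega, Nat.add_sub_cancel_left, coeff_mul_t_pow]
    · intro j hj
      rw [show j = (j - (m - d)) + (m - d) by omega, coeff_mul_t_pow]
      exact htop _ (by omega)
  · rintro _ ⟨a, rfl⟩
    refine ⟨D.i_mem (by omega) a, fun y hy z hz => ?_⟩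
    refine (pmul_assoc_iff hf (q := 0) (r := D.i a * y) (by simp) (D.deg_i_mul_lt a hy)).2
      ⟨0, by simp⟩

/-- **Petit**: if `Nuc_r(S_f) ≠ S_f` then the middle nucleus of `S_f` is `K`. -/
lemma nucm_eq (hf : D.deg f = (m : WithBot ℕ)) (hm : 2 ≤ m) (hne : ¬D.SfSet m ⊆ D.nucr f m) :
    D.nucm f m = Set.range D.i := by
  refine Set.Subset.antisymm (fun x hx => ?_) ?_
  · by_contra hxi
    obtain ⟨d, hd0, hdm, hd, htop⟩ := exists_top hx.1 hxi
    refine hne fun z hz => (mem_nucr_iff hf hm).2 ⟨hz, ?_⟩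
    obtain ⟨h1, h2⟩ := D.t_pow_mul_top htop (m - d)
    rw [show d + (m - d) = m by omega] at h1 h2
    exact exists_mul_of_top hf (x := D.t ^ (m - d)) (y := x) (by rwa [h1]) h2
      (hx.2 _ (D.t_pow_mem (by omega)) _ hz)
  · rintro _ ⟨a, rfl⟩
    refine ⟨D.i_mem (by omega) a, fun y hy z hz => ?_⟩
    refine (pmul_assoc_iff hf (q := 0) (r := y * D.i a) (by simp) ?_).2 ⟨0, by simp⟩
    clear hz z
    rw [mem_SfSet] at hy ⊢
    have key : ∀ n, (∀ j, n < j → D.coeff (D.t ^ n * D.i a) j = 0) := fun n j hj =>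
      (D.t_pow_mul_top (x := D.i a) (d := 0)
        (fun j hj => by rw [coeff_i, Finsupp.single_eq_of_ne (by omega)]) n).2 j (by omega)
    rw [D.repr' y, Finsupp.sum, Finset.sum_mul]
    change _ ∈ {x : R | ∀ j, m ≤ j → D.coeff x j = 0}
    have hS : {x : R | ∀ j, m ≤ j → D.coeff x j = 0} = (D.res m : Set R) := by
      ext x; exact D.deg_lt_iff.symm
    rw [hS]
    refine sum_mem fun n hn => D.deg_lt_iff.2 fun j hj => ?_
    have hnm : n < m := by
      by_contra h
      exact (Finsupp.mem_support_iff.1 hn) (hy n (by omega))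
    rw [mul_assoc, coeff_smul, Finsupp.smul_apply, key n j (by omega), smul_zero]

end Division

end DiffPolyRing

namespace Der

variable {K : Type} [Field K] (δ : Der K)

/-- A `Der` as an additive map. -/
def addHom : K →+ K := AddMonoidHom.mk' δ.toFun δ.map_add'

/-- Left multiplication by `t` on differential polynomials, in coefficients. -/
noncomputable def tEnd : AddMonoid.End (ℕ →₀ K) :=
  Finsupp.mapRange.addMonoidHom δ.addHom + Finsupp.mapDomain.addMonoidHom (· + 1)

lemma tEnd_apply (v : ℕ →₀ K) :
    δ.tEnd v = Finsupp.mapRange.addMonoidHom δ.addHom v + Finsupp.mapDomain (· + 1) v := rfl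

lemma tEnd_apply_zero (v : ℕ →₀ K) : δ.tEnd v 0 = δ.toFun (v 0) := by
  rw [tEnd_apply, Finsupp.add_apply, Finsupp.mapDomain_of_notMem_range _ _ (by simp), add_zero]
  rfl

lemma tEnd_apply_succ (v : ℕ →₀ K) (n : ℕ) :
    δ.tEnd v (n + 1) = δ.toFun (v (n + 1)) + v n := by
  rw [tEnd_apply, Finsupp.add_apply, Finsupp.mapDomain_apply (add_left_injective 1)]
  rfl

lemma tEnd_smul (a : K) (v : ℕ →₀ K) :
    δ.tEnd (a • v) = a • δ.tEnd v + δ.toFun a • v := by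
  ext n
  rcases n with _ | n
  · simp [tEnd_apply_zero, δ.leibniz']
  · simp only [tEnd_apply_succ, Finsupp.add_apply, Finsupp.smul_apply, smul_eq_mul, δ.leibniz']
    ring

lemma addHom_one : δ.toFun 1 = 0 := by simpa using δ.leibniz' 1 1

lemma addHom_zero : δ.toFun 0 = 0 := by simpa using δ.map_add' 0 0

lemma tEnd_pow_top {v : ℕ →₀ K} {d : ℕ} (hd : ∀ j, d < j → v j = 0) (k : ℕ) :
    (δ.tEnd ^ k) v (d + k) = v d ∧ ∀ j, d + k < j → (δ.tEnd ^ k) v j = 0 := by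
  induction k with
  | zero => exact ⟨rfl, hd⟩
  | succ k ih =>
    have h : ∀ n, (δ.tEnd ^ (k + 1)) v (n + 1) =
        δ.toFun ((δ.tEnd ^ k) v (n + 1)) + (δ.tEnd ^ k) v n := fun n => by
      rw [pow_succ']; exact δ.tEnd_apply_succ _ n
    refine ⟨?_, fun j hj => ?_⟩
    · rw [← add_assoc, h, ih.2 _ (by omega), addHom_zero, zero_add, ih.1]
    · obtain ⟨j, rfl⟩ : ∃ i, j = i + 1 := ⟨j - 1, by omega⟩
      rw [h, ih.2 _ (by omega), ih.2 _ (by omega), addHom_zero, zero_add]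

lemma tEnd_pow_single (n : ℕ) :
    (δ.tEnd ^ n) (Finsupp.single 0 1) = Finsupp.single n 1 := by
  induction n with
  | zero => rfl
  | succ n ih =>
    rw [pow_succ']
    refine (congrArg δ.tEnd ih).trans ?_
    ext j
    rcases j with _ | j
    · rw [tEnd_apply_zero]
      by_cases h : n = 0 <;> simp [h, addHom_one, addHom_zero]
    · rw [tEnd_apply_succ]
      by_cases h : n = j + 1 <;> simp [Finsupp.single_apply, h, addHom_one, addHom_zero]

/-- The operator on `ℕ →₀ K` of left multiplication by `∑ aₙ tⁿ`. -/
noncomputable def polyEnd : (ℕ →₀ K) →+ AddMonoid.End (ℕ →₀ K) :=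
  Finsupp.liftAddHom fun n =>
    (AddMonoidHom.mulRight (δ.tEnd ^ n)).comp (Module.toAddMonoidEnd K (ℕ →₀ K)).toAddMonoidHom

lemma polyEnd_eq_sum (c : ℕ →₀ K) : δ.polyEnd c =
    c.sum fun n a => Module.toAddMonoidEnd K (ℕ →₀ K) a * δ.tEnd ^ n := rfl

lemma polyEnd_single (n : ℕ) (a : K) : δ.polyEnd (Finsupp.single n a) =
    Module.toAddMonoidEnd K (ℕ →₀ K) a * δ.tEnd ^ n := by
  simp [polyEnd_eq_sum]

lemma polyEnd_apply (c v : ℕ →₀ K) : δ.polyEnd c v = c.sum fun n a => a • (δ.tEnd ^ n) v := by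
  induction c using Finsupp.induction_linear with
  | zero => simp
  | add f g hf hg =>
    rw [Finsupp.sum_add_index' (by simp) (by intro n a b; rw [add_smul]), ← hf, ← hg, map_add]
    rfl
  | single n a => rw [polyEnd_single]; simp; rfl

lemma polyEnd_one (c : ℕ →₀ K) : δ.polyEnd c (Finsupp.single 0 1) = c := by
  rw [polyEnd_apply]
  conv_rhs => rw [← c.sum_single]
  exact Finsupp.sum_congr fun n _ => by simp [tEnd_pow_single]

lemma polyEnd_top {c v : ℕ →₀ K} {N d : ℕ} (hN : ∀ j, N < j → c j = 0)
    (hd : ∀ j, d < j → v j = 0) :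
    δ.polyEnd c v (N + d) = c N * v d ∧ ∀ j, N + d < j → δ.polyEnd c v j = 0 := by
  have hle : ∀ n ∈ c.support, n ≤ N := fun n hn => by
    by_contra h
    exact (Finsupp.mem_support_iff.1 hn) (hN n (by omega))
  rw [polyEnd_apply, Finsupp.sum]
  refine ⟨?_, fun j hj => ?_⟩
  · rw [Finsupp.finsetSum_apply, Finset.sum_eq_single N]
    · rw [Finsupp.smul_apply, add_comm, (δ.tEnd_pow_top hd N).1, smul_eq_mul]
    · intro n hn hne
      have := hle n hn
      rw [Finsupp.smul_apply, (δ.tEnd_pow_top hd n).2 _ (by omega), smul_zero]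
    · intro h
      rw [Finsupp.notMem_support_iff.1 h, zero_smul, Finsupp.zero_apply]
  · rw [Finsupp.finsetSum_apply]
    refine Finset.sum_eq_zero fun n hn => ?_
    have := hle n hn
    rw [Finsupp.smul_apply, (δ.tEnd_pow_top hd n).2 _ (by omega), smul_zero]

lemma tEnd_mul_smul (a : K) : δ.tEnd * Module.toAddMonoidEnd K (ℕ →₀ K) a =
    Module.toAddMonoidEnd K (ℕ →₀ K) a * δ.tEnd +
      Module.toAddMonoidEnd K (ℕ →₀ K) (δ.toFun a) :=
  AddMonoidHom.ext fun v => δ.tEnd_smul a v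

/-- The additive group of operators of left multiplication by differential polynomials. -/
noncomputable def polyRange : AddSubgroup (AddMonoid.End (ℕ →₀ K)) := δ.polyEnd.range

lemma smul_mul_mem (a : K) {x : AddMonoid.End (ℕ →₀ K)} (hx : x ∈ δ.polyRange) :
    Module.toAddMonoidEnd K (ℕ →₀ K) a * x ∈ δ.polyRange := by
  obtain ⟨c, rfl⟩ := hx
  induction c using Finsupp.induction_linear with
  | zero => simp
  | add f g hf hg => rw [map_add, mul_add]; exact add_mem hf hg
  | single n b =>
    exact ⟨Finsupp.single n (a * b), by rw [polyEnd_single, polyEnd_single, map_mul, mul_assoc]⟩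

lemma tEnd_mul_mem {x : AddMonoid.End (ℕ →₀ K)} (hx : x ∈ δ.polyRange) :
    δ.tEnd * x ∈ δ.polyRange := by
  obtain ⟨c, rfl⟩ := hx
  induction c using Finsupp.induction_linear with
  | zero => simp
  | add f g hf hg => rw [map_add, mul_add]; exact add_mem hf hg
  | single n b =>
    refine ⟨Finsupp.single (n + 1) b + Finsupp.single n (δ.toFun b), ?_⟩
    rw [map_add, polyEnd_single, polyEnd_single, polyEnd_single, ← mul_assoc, tEnd_mul_smul,
      add_mul, mul_assoc, ← pow_succ']

/-- A model of the differential polynomial ring `K[t;δ]`. -/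
noncomputable def polySubring : Subring (AddMonoid.End (ℕ →₀ K)) where
  __ := δ.polyRange
  one_mem' := ⟨Finsupp.single 0 1, by rw [polyEnd_single]; simp⟩
  mul_mem' := by
    intro x y hx hy
    obtain ⟨c, rfl⟩ := hx
    change _ ∈ δ.polyRange
    rw [polyEnd_eq_sum, Finsupp.sum, Finset.sum_mul]
    refine sum_mem fun n _ => ?_
    rw [mul_assoc]
    refine δ.smul_mul_mem _ ?_
    clear * - hy
    induction n with
    | zero => simpa using hy
    | succ n ih => rw [pow_succ', mul_assoc]; exact δ.tEnd_mul_mem ih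

lemma mem_polySubring {x : AddMonoid.End (ℕ →₀ K)} :
    x ∈ δ.polySubring ↔ ∃ c, δ.polyEnd c = x := Iff.rfl

lemma polyEnd_coeff (x : δ.polySubring) : δ.polyEnd (x.1 (Finsupp.single 0 1)) = x.1 := by
  obtain ⟨c, hc⟩ := x.2
  change δ.polyEnd c = x.1 at hc
  rw [← hc, polyEnd_one]

lemma support_max_lt_iff {c : ℕ →₀ K} {n : ℕ} :
    c.support.max < (n : WithBot ℕ) ↔ ∀ j, n ≤ j → c j = 0 := by
  refine (Finset.sup_lt_iff (WithBot.bot_lt_coe n)).trans ⟨fun h j hj => ?_, fun h j hj => ?_⟩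
  · by_contra hne
    exact absurd (WithBot.coe_lt_coe.1 (h j (Finsupp.mem_support_iff.2 hne))) (not_lt.2 hj)
  · refine WithBot.coe_lt_coe.2 (lt_of_not_ge fun hn => ?_)
    exact (Finsupp.mem_support_iff.1 hj) (h j hn)

lemma exists_support_max {c : ℕ →₀ K} (hc : c ≠ 0) :
    ∃ d : ℕ, c.support.max = d ∧ c d ≠ 0 ∧ ∀ j, d < j → c j = 0 := by
  obtain ⟨d, hd⟩ := Finset.max_of_nonempty (Finsupp.support_nonempty_iff.2 hc)
  refine ⟨d, hd, Finsupp.mem_support_iff.1 (Finset.mem_of_max hd), fun j hj => ?_⟩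
  refine support_max_lt_iff (n := d + 1).1 ?_ j hj
  rw [hd]
  exact WithBot.coe_lt_coe.2 (Nat.lt_succ_self d)

lemma exists_quotient {f : δ.polySubring} {d : ℕ} (hd : f.1 (Finsupp.single 0 1) d ≠ 0)
    (htop : ∀ j, d < j → f.1 (Finsupp.single 0 1) j = 0) (n : ℕ) (x : δ.polySubring)
    (hx : ∀ j, n ≤ j → x.1 (Finsupp.single 0 1) j = 0) :
    ∃ q r : δ.polySubring, x = q * f + r ∧ ∀ j, d ≤ j → r.1 (Finsupp.single 0 1) j = 0 := by
  induction n generalizing x with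
  | zero => exact ⟨0, x, by simp, fun j _ => hx j (Nat.zero_le j)⟩
  | succ n ih =>
    by_cases hnd : n < d
    · exact ⟨0, x, by simp, fun j hj => hx j (by omega)⟩
    · set a := x.1 (Finsupp.single 0 1) n / f.1 (Finsupp.single 0 1) d with ha
      let q₀ : δ.polySubring := ⟨δ.polyEnd (Finsupp.single (n - d) a), _, rfl⟩
      have hq := δ.polyEnd_top (c := Finsupp.single (n - d) a) (N := n - d)
        (fun j hj => Finsupp.single_eq_of_ne (by omega)) htop
      rw [Nat.sub_add_cancel (by omega)] at hq
      have hval : ∀ j, (x - q₀ * f).1 (Finsupp.single 0 1) j =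
          x.1 (Finsupp.single 0 1) j -
            δ.polyEnd (Finsupp.single (n - d) a) (f.1 (Finsupp.single 0 1)) j := fun j => rfl
      obtain ⟨q, r, h, hr⟩ := ih (x - q₀ * f) fun j hj => by
        rw [hval]
        rcases hj.eq_or_lt with rfl | hj
        · rw [hq.1, Finsupp.single_eq_same, ha, div_mul_cancel₀ _ hd, sub_self]
        · rw [hq.2 j hj, hx j hj, sub_zero]
      exact ⟨q + q₀, r, by rw [sub_eq_iff_eq_add.1 h, add_mul]; abel, hr⟩

lemma toAddMonoidEnd_mem (a : K) : Module.toAddMonoidEnd K (ℕ →₀ K) a ∈ δ.polySubring :=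
  δ.mem_polySubring.2 ⟨Finsupp.single 0 a, by rw [polyEnd_single]; simp⟩

lemma tEnd_mem : δ.tEnd ∈ δ.polySubring :=
  δ.mem_polySubring.2 ⟨Finsupp.single 1 1, by rw [polyEnd_single]; simp⟩

/-- The constant differential polynomials. -/
noncomputable def polyConst : K →+* δ.polySubring :=
  (Module.toAddMonoidEnd K (ℕ →₀ K)).codRestrict δ.polySubring δ.toAddMonoidEnd_mem

/-- The variable of the differential polynomial ring. -/
noncomputable def polyT : δ.polySubring := ⟨δ.tEnd, δ.tEnd_mem⟩

lemma coe_sum (c : ℕ →₀ K) :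
    ((c.sum fun n a => δ.polyConst a * δ.polyT ^ n : δ.polySubring) :
      AddMonoid.End (ℕ →₀ K)) = δ.polyEnd c := by
  rw [polyEnd_eq_sum, Finsupp.sum, Finsupp.sum, AddSubmonoidClass.coe_finsetSum]
  rfl

/-- `polySubring` realizes the differential polynomial ring `K[t;δ]`. -/
noncomputable def polyRing : DiffPolyRing K δ δ.polySubring where
  i := δ.polyConst
  t := δ.polyT
  coeff x := x.1 (Finsupp.single 0 1)
  t_mul a := Subtype.ext (δ.tEnd_mul_smul a)
  repr' x := Subtype.ext <| by rw [coe_sum, polyEnd_coeff]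
  coeff_unique x c hx := by rw [hx, coe_sum, polyEnd_one]
  rightDiv f x hf := by
    have hc : f.1 (Finsupp.single 0 1) ≠ 0 := fun h => hf <| Subtype.ext <| by
      rw [← δ.polyEnd_coeff f, h, map_zero]; rfl
    obtain ⟨d, hmax, hd, htop⟩ := exists_support_max hc
    simp only [hmax, support_max_lt_iff]
    obtain ⟨n, hn⟩ : ∃ n : ℕ, ∀ j, n ≤ j → x.1 (Finsupp.single 0 1) j = 0 := by
      by_cases h0 : x.1 (Finsupp.single 0 1) = 0
      · exact ⟨0, fun j _ => by rw [h0]; rfl⟩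
      · obtain ⟨N, -, -, h⟩ := exists_support_max h0
        exact ⟨N + 1, h⟩
    obtain ⟨q, r, h, hr⟩ := δ.exists_quotient hd htop n x hn
    refine ⟨r, ⟨⟨q, h⟩, hr⟩, ?_⟩
    rintro r' ⟨⟨q', h'⟩, hr'⟩
    have hqr : (q - q') * f = r' - r := by
      rw [sub_mul, sub_eq_sub_iff_add_eq_add, ← h, h', add_comm]
    by_cases hq : q - q' = 0
    · rw [hq, zero_mul] at hqr
      exact sub_eq_zero.1 hqr.symm
    · exfalso
      have hqc : (q - q').1 (Finsupp.single 0 1) ≠ 0 := fun h => hq <| Subtype.ext <| by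
        rw [← δ.polyEnd_coeff (q - q'), h, map_zero]; rfl
      obtain ⟨N, -, hN, hNtop⟩ := exists_support_max hqc
      have h1 := (δ.polyEnd_top hNtop htop).1
      rw [polyEnd_coeff] at h1
      have h2 : ((q - q') * f).1 (Finsupp.single 0 1) (N + d) =
        (r' - r).1 (Finsupp.single 0 1) (N + d) := by rw [hqr]
      have h3 : (r' - r).1 (Finsupp.single 0 1) (N + d) = r'.1 (Finsupp.single 0 1) (N + d) -
        r.1 (Finsupp.single 0 1) (N + d) := rfl
      rw [h3, hr _ (by omega), hr' _ (by omega), sub_zero] at h2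
      exact mul_ne_zero hN hd (h1.symm.trans h2)

end Der

namespace DiffPolyRing

variable {K : Type} [Field K] {δ : Der K} {R : Type} [Ring R] {D : DiffPolyRing K δ R}
  {V : Type} [AddCommGroup V] [Module K V] {nabla : AddMonoid.End V}

lemma act_one (v : V) : D.act nabla 1 v = v := by
  have h1 : D.act nabla (1 : R) = 1 := by simpa using D.act_monomial nabla 1 0
  rw [h1]; rfl

lemma act_t_pow (n : ℕ) : D.act nabla (D.t ^ n) = nabla ^ n := by
  have h1 := D.act_monomial nabla 1 n
  rwa [map_one, map_one, one_mul, one_mul] at h1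

lemma act_add_apply (x y : R) (v : V) :
    D.act nabla (x + y) v = D.act nabla x v + D.act nabla y v := by
  rw [act_add]; rfl

lemma act_neg_apply (x : R) (v : V) : D.act nabla (-x) v = -D.act nabla x v := by
  have h := D.act_i_mul_apply (nabla := nabla) (-1) x v
  rwa [map_neg, map_one, neg_one_mul, neg_one_smul] at h

lemma act_apply_of_mem {m : ℕ} {g : R} (hg : g ∈ D.SfSet m) (v : V) :
    D.act nabla g v = ∑ i : Fin m, D.coeff g i • (nabla ^ (i : ℕ)) v := by
  have hs : (D.coeff g).support ⊆ Finset.range m := fun n hn => by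
    by_contra h
    rw [Finset.mem_range, not_lt] at h
    exact (Finsupp.mem_support_iff.1 hn) (D.mem_SfSet.1 hg n h)
  rw [act, Finsupp.sum_of_support_subset _ hs _ (by simp), ← Fin.sum_univ_eq_sum_range
    (fun n => Module.toAddMonoidEnd K V (D.coeff g n) * nabla ^ n)]
  exact AddMonoidHom.finsetSum_apply _ _ _

variable {m : ℕ} {v₀ : V}

lemma exists_act_eq (b : Module.Basis (Fin m) K V)
    (hb : ∀ i : Fin m, b i = (nabla ^ (i : ℕ)) v₀)
    (v : V) : ∃ g ∈ D.SfSet m, D.act nabla g v₀ = v := by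
  have hmem : ∑ i : Fin m, D.i (b.repr v i) * D.t ^ (i : ℕ) ∈ D.res m :=
    sum_mem fun i _ => D.deg_i_mul_lt _ (D.t_pow_mem i.2)
  refine ⟨_, hmem, ?_⟩
  have hact : D.act nabla (∑ i : Fin m, D.i (b.repr v i) * D.t ^ (i : ℕ)) =
      ∑ i : Fin m, D.act nabla (D.i (b.repr v i) * D.t ^ (i : ℕ)) :=
    map_sum (AddMonoidHom.mk' (D.act nabla) (D.act_add nabla)) _ _
  rw [hact]
  conv_rhs => rw [← b.sum_repr v]
  refine (AddMonoidHom.finsetSum_apply _ _ _).trans (Finset.sum_congr rfl fun i _ => ?_)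
  refine (D.act_i_mul_apply _ _ _).trans ?_
  rw [act_t_pow, hb]

lemma eq_zero_of_act_eq_zero (b : Module.Basis (Fin m) K V)
    (hb : ∀ i : Fin m, b i = (nabla ^ (i : ℕ)) v₀)
    {g : R} (hg : g ∈ D.SfSet m) (h : D.act nabla g v₀ = 0) : g = 0 := by
  rw [act_apply_of_mem hg] at h
  simp only [← hb] at h
  have h0 := Fintype.linearIndependent_iff.1 b.linearIndependent _ h
  refine D.coeff_injective ?_
  rw [coeff_zero]
  ext j
  by_cases hj : j < m
  · exact h0 ⟨j, hj⟩
  · exact D.mem_SfSet.1 hg j (not_lt.1 hj)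

lemma eq_of_act_eq (b : Module.Basis (Fin m) K V)
    (hb : ∀ i : Fin m, b i = (nabla ^ (i : ℕ)) v₀)
    {g h : R} (hg : g ∈ D.SfSet m) (hh : h ∈ D.SfSet m)
    (e : D.act nabla g v₀ = D.act nabla h v₀) : g = h := by
  rw [← sub_eq_zero]
  refine eq_zero_of_act_eq_zero b hb ((D.res m).sub_mem hg hh) ?_
  rw [sub_eq_add_neg, act_add_apply, act_neg_apply, e, add_neg_cancel]

/-- The annihilator of a cyclic vector of an `m`-dimensional differential module is generated by
a differential polynomial of degree `m`. -/
lemma exists_annihilator (b : Module.Basis (Fin m) K V)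
    (hb : ∀ i : Fin m, b i = (nabla ^ (i : ℕ)) v₀) :
    ∃ f : R, D.deg f = (m : WithBot ℕ) ∧ D.act nabla f v₀ = 0 := by
  obtain ⟨g, hg, hgm⟩ := exists_act_eq (D := D) b hb ((nabla ^ m) v₀)
  refine ⟨D.t ^ m - g, deg_eq_iff.2 ⟨?_, fun j hj => ?_⟩, ?_⟩
  · rw [coeff_sub, coeff_t_pow, Finsupp.sub_apply, D.mem_SfSet.1 hg m le_rfl]
    simp
  · rw [coeff_sub, coeff_t_pow, Finsupp.sub_apply, D.mem_SfSet.1 hg j hj.le,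
      Finsupp.single_eq_of_ne (by omega), sub_zero]
  · rw [sub_eq_add_neg, act_add_apply, act_neg_apply, hgm, act_t_pow, add_neg_cancel]

/-- The right nucleus of `S_f`, for `f` the annihilator of a cyclic vector of a differential
module, is the opposite of the algebra of horizontal endomorphisms. -/
lemma rightNucPresents (b : Module.Basis (Fin m) K V)
    (hb : ∀ i : Fin m, b i = (nabla ^ (i : ℕ)) v₀)
    (hn : ∀ (a : K) (v : V), nabla (a • v) = δ.toFun a • v + a • nabla v)
    {F : Type} [Field F] [Algebra F K] {B : Type} [Ring B] [Algebra F B]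
    (hm : 2 ≤ m) {f : R} (hf : D.deg f = (m : WithBot ℕ)) (hf0 : D.act nabla f v₀ = 0)
    (a : B →+ (V →ₗ[K] V)) (hmul : ∀ x y v, a (x * y) v = a y (a x v))
    (halg : ∀ (c : F) v, a (algebraMap F B c) v = algebraMap F K c • v)
    (hinj : Function.Injective a) (hcomm : ∀ d v, a d (nabla v) = nabla (a d v))
    (hsurj : ∀ T : V →ₗ[K] V, (∀ v, T (nabla v) = nabla (T v)) → ∃ d, a d = T) :
    D.RightNucPresents F f m B := by
  have hker : ∀ x : R, (∃ q, x = q * f) ↔ D.act nabla x v₀ = 0 := fun x => by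
    constructor
    · rintro ⟨q, rfl⟩
      rw [D.act_mul_apply hn, hf0, map_zero]
    · intro hx
      obtain ⟨⟨q, hq⟩, hr⟩ := modr_spec hf x
      refine ⟨q, ?_⟩
      rw [hq, act_add_apply, D.act_mul_apply hn, hf0, map_zero, zero_add] at hx
      rw [eq_zero_of_act_eq_zero b hb hr hx, add_zero] at hq
      exact hq
  have hnuc : ∀ g, g ∈ D.nucr f m ↔ g ∈ D.SfSet m ∧ D.act nabla f (D.act nabla g v₀) = 0 :=
    fun g => by rw [mem_nucr_iff hf hm, hker, D.act_mul_apply hn]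
  have hact : ∀ d x v, D.act nabla x (a d v) = a d (D.act nabla x v) := fun d =>
    D.act_comm (hcomm d)
  choose φ hφ hφv using fun d : B => exists_act_eq (D := D) b hb (a d v₀)
  have hφn : ∀ d, φ d ∈ D.nucr f m := fun d =>
    (hnuc _).2 ⟨hφ d, by rw [hφv, hact, hf0, map_zero]⟩
  have hφu : ∀ {g d}, g ∈ D.SfSet m → D.act nabla g v₀ = a d v₀ → φ d = g := fun hg h =>
    eq_of_act_eq b hb (hφ _) hg (by rw [hφv, h])
  have hφi : Function.Injective φ := fun d d' h => by
    refine hinj (LinearMap.ext fun v => ?_)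
    obtain ⟨x, -, rfl⟩ := exists_act_eq (D := D) b hb v
    rw [← hact, ← hact, ← hφv, ← hφv, h]
  have hφs : ∀ g ∈ D.nucr f m, ∃ d, φ d = g := fun g hg => by
    obtain ⟨hgm, hg0⟩ := (hnuc g).1 hg
    set T : V →ₗ[K] V := b.constr K fun i => (nabla ^ (i : ℕ)) (D.act nabla g v₀)
    have hT : ∀ x, T (D.act nabla x v₀) = D.act nabla x (D.act nabla g v₀) := fun x => by
      obtain ⟨⟨q, hq⟩, hr⟩ := modr_spec hf x
      rw [hq, act_add_apply, act_add_apply, D.act_mul_apply hn, D.act_mul_apply hn, hf0, hg0,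
        map_zero, zero_add, zero_add, act_apply_of_mem hr, act_apply_of_mem hr, map_sum]
      refine Finset.sum_congr rfl fun i _ => ?_
      rw [map_smul, ← hb, Module.Basis.constr_basis]
    obtain ⟨d, hd⟩ := hsurj T fun v => by
      obtain ⟨x, -, rfl⟩ := exists_act_eq (D := D) b hb v
      have h1 : ∀ w, nabla w = D.act nabla D.t w := fun w => by
        simpa using congrArg (fun h : AddMonoid.End V => h w)
          (D.act_t_pow (nabla := nabla) 1).symm
      rw [h1, ← D.act_mul_apply hn, hT, hT, D.act_mul_apply hn, h1]
    refine ⟨d, hφu hgm ?_⟩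
    simpa [hd, act_one] using (hT 1).symm
  refine ⟨Equiv.ofBijective (fun d => ⟨φ d, hφn d⟩)
    ⟨fun d d' h => hφi (congrArg Subtype.val h), fun g => ?_⟩, fun x y => ?_, fun x y => ?_,
    fun c => ?_⟩
  · obtain ⟨d, hd⟩ := hφs g g.2
    exact ⟨d, Subtype.ext hd⟩
  · refine hφu ((D.res m).add_mem (hφ x) (hφ y)) ?_
    change D.act nabla (φ x + φ y) v₀ = _
    rw [act_add_apply, hφv, hφv, map_add]
    rfl
  · change φ (x * y) = D.modr f (φ x * φ y)
    obtain ⟨⟨q, hq⟩, hr⟩ := modr_spec hf (φ x * φ y)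
    refine hφu hr ?_
    have h := congrArg (fun z => D.act nabla z v₀) hq
    simp only [act_add_apply, D.act_mul_apply hn, hf0, map_zero, zero_add] at h
    rw [← h, hφv, hact, hφv, hmul]
  · refine hφu (D.i_mem (by omega) _) ?_
    have h := D.act_i_mul_apply (nabla := nabla) (algebraMap F K c) 1 v₀
    rw [mul_one, act_one] at h
    rw [h, halg]

end DiffPolyRing

section InnerDerivation

variable {K : Type} [Field K] {n : Type} [Fintype n] [DecidableEq n]

/-- Every `K`-linear derivation of a matrix algebra is inner. -/
lemma Matrix.exists_inner_of_derivation [Nonempty n] (G : Matrix n n K →ₗ[K] Matrix n n K)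
    (hG : ∀ M N, G (M * N) = M * G N + G M * N) : ∃ B, ∀ M, G M = B * M - M * B := by
  obtain ⟨o⟩ := ‹Nonempty n›
  refine ⟨∑ i, G (Matrix.single i o 1) * Matrix.single o i 1, fun M => ?_⟩
  have h1 : ∀ i, M * Matrix.single i o (1 : K) = ∑ j, M j i • Matrix.single j o 1 := fun i => by
    ext p q
    simp [Matrix.mul_apply, Matrix.sum_apply, Matrix.single_apply, ite_and]
  have h2 : ∀ j, Matrix.single o j (1 : K) * M = ∑ i, M j i • Matrix.single o i 1 := fun i => by
    ext p q
    simp [Matrix.mul_apply, Matrix.sum_apply, Matrix.single_apply, ite_and]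
  have h3 : ∑ i, Matrix.single i o (1 : K) * Matrix.single o i 1 = (1 : Matrix n n K) := by
    ext p q
    simp [Matrix.sum_apply, Matrix.single_apply, Matrix.one_apply, ite_and, eq_comm]
  have h4 : ∀ i, M * (G (Matrix.single i o 1) * Matrix.single o i 1) =
      (∑ j, G (Matrix.single j o 1) * (M j i • Matrix.single o i 1)) -
        G M * (Matrix.single i o 1 * Matrix.single o i 1) := fun i => by
    have h := congrArg G (h1 i)
    rw [hG, map_sum] at h
    rw [← mul_assoc, ← mul_assoc, eq_sub_of_add_eq h, sub_mul, Finset.sum_mul]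
    simp only [map_smul, Algebra.smul_mul_assoc, Algebra.mul_smul_comm]
  rw [Finset.mul_sum, Finset.sum_congr rfl fun i _ => h4 i, Finset.sum_sub_distrib,
    ← Finset.mul_sum, h3, mul_one, Finset.sum_mul, Finset.sum_comm]
  simp_rw [← Finset.mul_sum, mul_assoc, h2]
  rw [sub_sub_cancel]

end InnerDerivation

namespace Der

variable {K : Type} [Field K] {δ : Der K} {F : Type} [Field F] [Algebra F K]

lemma HasConstants.map_algebraMap (hδ : δ.HasConstants F) (c : F) :
    δ.toFun (algebraMap F K c) = 0 := (hδ _).2 ⟨c, rfl⟩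

/-- A derivation as a linear map over its field of constants. -/
def HasConstants.linearMap (hδ : δ.HasConstants F) : K →ₗ[F] K where
  toFun := δ.toFun
  map_add' := δ.map_add'
  map_smul' c x := by
    rw [Algebra.smul_def, δ.leibniz', hδ.map_algebraMap, zero_mul, add_zero, ← Algebra.smul_def]
    rfl

lemma HasConstants.exact (hδ : δ.HasConstants F) :
    Function.Exact (Algebra.linearMap F K) hδ.linearMap := fun a => hδ a

variable {A : Type} [Ring A] [Algebra F A]

lemma HasConstants.rTensor_mul (hδ : δ.HasConstants F) (x y : K ⊗[F] A) :
    hδ.linearMap.rTensor A (x * y) =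
      x * hδ.linearMap.rTensor A y + hδ.linearMap.rTensor A x * y := by
  induction x with
  | zero => simp
  | add x x' hx hx' => rw [add_mul, map_add, hx, hx', map_add, add_mul, add_mul]; abel
  | tmul a u =>
    induction y with
    | zero => simp
    | add y y' hy hy' => rw [mul_add, map_add, hy, hy', map_add, mul_add, mul_add]; abel
    | tmul b v =>
      simp only [Algebra.TensorProduct.tmul_mul_tmul, LinearMap.rTensor_tmul]
      rw [← TensorProduct.add_tmul]
      exact congrArg (· ⊗ₜ[F] (u * v)) (δ.leibniz' a b)

lemma HasConstants.rTensor_smul (hδ : δ.HasConstants F) (a : K) (x : K ⊗[F] A) :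
    hδ.linearMap.rTensor A (a • x) =
      a • hδ.linearMap.rTensor A x + δ.toFun a • x := by
  induction x with
  | zero => simp
  | add x x' hx hx' => rw [smul_add, map_add, hx, hx', map_add, smul_add, smul_add]; abel
  | tmul b u =>
    simp only [TensorProduct.smul_tmul', LinearMap.rTensor_tmul]
    rw [← TensorProduct.add_tmul]
    exact congrArg (· ⊗ₜ[F] u) (δ.leibniz' a b)

lemma HasConstants.rTensor_eq_zero_iff (hδ : δ.HasConstants F) (x : K ⊗[F] A) :
    hδ.linearMap.rTensor A x = 0 ↔ ∃ d : A, 1 ⊗ₜ[F] d = x := by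
  refine (Module.Flat.rTensor_exact A hδ.exact x).trans ⟨?_, ?_⟩
  · rintro ⟨z, rfl⟩
    refine ⟨TensorProduct.lid F A z, ?_⟩
    induction z with
    | zero => simp
    | add z w hz hw => rw [map_add, TensorProduct.tmul_add, hz, hw, map_add]
    | tmul c d =>
      rw [TensorProduct.lid_tmul, LinearMap.rTensor_tmul, ← TensorProduct.smul_tmul,
        Algebra.linearMap_apply, Algebra.algebraMap_eq_smul_one]
  · rintro ⟨d, rfl⟩
    exact ⟨1 ⊗ₜ d, by simp⟩

lemma map_mul_matrix {n : Type} [Fintype n] (M N : Matrix n n K) :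
    (M * N).map δ.toFun = M * N.map δ.toFun + M.map δ.toFun * N := by
  ext i j
  have h : ∀ s : n → K, δ.toFun (∑ k, s k) = ∑ k, δ.toFun (s k) := fun s =>
    map_sum δ.addHom s _
  simp [Matrix.mul_apply, h, δ.leibniz', Finset.sum_add_distrib]

/-- If `K` splits `A`, the image of `A` in the matrix algebra is the algebra of horizontal
endomorphisms of some connection. -/
lemma HasConstants.exists_connection (hδ : δ.HasConstants F) {n : Type} [Fintype n]
    [DecidableEq n] [Nonempty n] (Φ : (K ⊗[F] A) ≃ₐ[K] Matrix n n K) :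
    ∃ B : Matrix n n K, ∀ M : Matrix n n K,
      M.map δ.toFun = B * M - M * B ↔ ∃ d : A, Φ (1 ⊗ₜ d) = M := by
  obtain ⟨B, hB⟩ := Matrix.exists_inner_of_derivation (K := K) (n := n)
    { toFun := fun M => M.map δ.toFun - Φ (hδ.linearMap.rTensor A (Φ.symm M))
      map_add' := fun M N => by
        have h : (M + N).map δ.toFun = M.map δ.toFun + N.map δ.toFun := by
          ext; simp [δ.map_add']
        rw [h, map_add, map_add, map_add]; abel
      map_smul' := fun a M => by
        have h : (a • M).map δ.toFun = a • M.map δ.toFun + δ.toFun a • M := by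
          ext; simp [δ.leibniz']
        rw [h, map_smul, hδ.rTensor_smul, map_add, map_smul, map_smul, Φ.apply_symm_apply,
          RingHom.id_apply, smul_sub]
        abel }
    (fun M N => by
      simp only [LinearMap.coe_mk, AddHom.coe_mk]
      rw [map_mul_matrix, map_mul, hδ.rTensor_mul, map_add, map_mul, map_mul,
        Φ.apply_symm_apply, Φ.apply_symm_apply, mul_sub, sub_mul]
      abel)
  refine ⟨B, fun M => ?_⟩
  rw [← hB M]
  simp only [LinearMap.coe_mk, AddHom.coe_mk]
  rw [eq_comm, sub_eq_self, map_eq_zero_iff Φ Φ.injective, hδ.rTensor_eq_zero_iff]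
  exact exists_congr fun d => (AlgEquiv.eq_symm_apply Φ)

end Der

section CyclicVector

open Polynomial Differential
open scoped Matrix

variable {K : Type} [Field K] [Differential K] {m : ℕ} (B : Matrix (Fin m) (Fin m) K)

/-- The connection `v ↦ v' + vB` on row vectors. -/
noncomputable def Matrix.connection : AddMonoid.End (Fin m → K) :=
  AddMonoidHom.mk' (fun v => (fun j => deriv (v j)) + v ᵥ* B) fun v w => by
    ext j
    simp [Matrix.add_vecMul]
    abel

/-- The extension of a connection to polynomial vectors, where `X' = 1`. -/
noncomputable def Matrix.polyConnection : AddMonoid.End (Fin m → K[X]) :=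
  AddMonoidHom.mk' (fun v => (fun j => implicitDeriv 1 (v j)) + v ᵥ* B.map C) fun v w => by
    ext1 j
    simp only [Matrix.add_vecMul, Pi.add_apply, map_add]
    abel

lemma Matrix.polyConnection_smul (p : K[X]) (v : Fin m → K[X]) :
    B.polyConnection (p • v) = implicitDeriv 1 p • v + p • B.polyConnection v := by
  ext1 j
  change implicitDeriv 1 (p * v j) + ((p • v) ᵥ* B.map C) j =
    implicitDeriv 1 p * v j + p * (implicitDeriv 1 (v j) + (v ᵥ* B.map C) j)
  rw [Derivation.leibniz, Matrix.smul_vecMul, Pi.smul_apply]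
  simp only [smul_eq_mul]
  ring

lemma Matrix.polyConnection_X_pow (n : ℕ) (z : Fin m → K[X]) :
    B.polyConnection ((X : K[X]) ^ (n + 1) • z) =
      (X : K[X]) ^ n • (((n : K[X]) + 1) • z + (X : K[X]) • B.polyConnection z) := by
  rw [polyConnection_smul, Derivation.leibniz_pow, implicitDeriv_X, smul_add, smul_smul, smul_smul,
    pow_succ]
  simp [mul_comm]

lemma Matrix.polyConnection_pow_X_pow (n : ℕ) : ∀ z : Fin m → K[X],
    (∀ i < n, ∀ j, ((B.polyConnection ^ i) ((X : K[X]) ^ n • z) j).eval 0 = 0) ∧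
      ∀ j, ((B.polyConnection ^ n) ((X : K[X]) ^ n • z) j).eval 0 = n.factorial * (z j).eval 0 := by
  induction n with
  | zero => exact fun z => ⟨by simp, by simp⟩
  | succ n ih =>
    intro z
    have h : ∀ i, (B.polyConnection ^ (i + 1)) ((X : K[X]) ^ (n + 1) • z) = (B.polyConnection ^ i)
        ((X : K[X]) ^ n • (((n : K[X]) + 1) • z + (X : K[X]) • B.polyConnection z)) := fun i => by
      rw [pow_succ, ← B.polyConnection_X_pow]
      rfl
    refine ⟨fun i hi j => ?_, fun j => ?_⟩
    · rcases i with _ | i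
      · simp
      · rw [h]
        exact (ih _).1 i (by omega) j
    · rw [h, (ih _).2]
      simp [Nat.factorial_succ]
      ring

lemma Matrix.exists_polyConnection_pow_eval [CharZero K] (e : ℕ → Fin m → K) (n : ℕ) :
    ∃ c : Fin m → K[X], ∀ i < n, ∀ j, ((B.polyConnection ^ i) c j).eval 0 = e i j := by
  induction n with
  | zero => exact ⟨0, by simp⟩
  | succ n ih =>
    obtain ⟨c, hc⟩ := ih
    set z : Fin m → K[X] := fun j =>
      C ((n.factorial : K)⁻¹ * (e n j - ((B.polyConnection ^ n) c j).eval 0)) with hz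
    refine ⟨c + (X : K[X]) ^ n • z, fun i hi j => ?_⟩
    rw [map_add, Pi.add_apply, eval_add]
    rcases Nat.lt_succ_iff_lt_or_eq.1 hi with hi | rfl
    · rw [hc i hi j, (B.polyConnection_pow_X_pow n z).1 i hi, add_zero]
    · rw [(B.polyConnection_pow_X_pow i z).2, hz]
      have : (i.factorial : K) ≠ 0 := Nat.cast_ne_zero.2 (Nat.factorial_ne_zero i)
      simp [this]

lemma Matrix.connection_eval {y : K} (hy : deriv y = 1) (c : Fin m → K[X]) (i : ℕ) :
    (B.connection ^ i) (fun j => (c j).eval y) = fun j => ((B.polyConnection ^ i) c j).eval y := by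
  induction i with
  | zero => rfl
  | succ i ih =>
    rw [pow_succ', pow_succ']
    refine (congrArg B.connection ih).trans ?_
    ext j
    set w := (B.polyConnection ^ i) c
    change deriv ((w j).eval y) + ((fun j => (w j).eval y) ᵥ* B) j =
      (implicitDeriv 1 (w j) + (w ᵥ* B.map C) j).eval y
    rw [eval_add]
    have h := deriv_aeval_eq_implicitDeriv (A := K) y 1 (by simpa using hy) (w j)
    rw [coe_aeval_eq_eval] at h
    rw [h]
    simp [Matrix.vecMul, dotProduct, eval_finsetSum]

/-- The cyclic vector theorem of Katz. -/
theorem Matrix.exists_cyclic_vector [CharZero K] {y : K} (hy : deriv y = 1) :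
    ∃ (v : Fin m → K) (b : Module.Basis (Fin m) K (Fin m → K)),
      ∀ i : Fin m, b i = (B.connection ^ (i : ℕ)) v := by
  obtain ⟨c, hc⟩ := B.exists_polyConnection_pow_eval
    (fun i j => if i = j then 1 else 0) m
  set M : Matrix (Fin m) (Fin m) K[X] := Matrix.of fun i j => (B.polyConnection ^ (i : ℕ)) c j
  have hev : ∀ x : K, M.det.eval x = (M.map (eval x)).det := fun x =>
    (RingHom.map_det (evalRingHom x) M)
  have hdet : M.det ≠ 0 := fun h0 => by
    have h1 : M.map (eval 0) = 1 := by
      ext i j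
      refine (hc i i.2 j).trans ?_
      simp [Matrix.one_apply, Fin.ext_iff]
    have h2 := hev 0
    rw [h0, h1] at h2
    simp at h2
  obtain ⟨a, ha⟩ : ∃ a : ℕ, M.det.eval (y - a) ≠ 0 := by
    by_contra! h
    refine hdet (eq_zero_of_infinite_isRoot _ (Set.Infinite.mono (s := Set.range fun a : ℕ => y - a)
      ?_ (Set.infinite_range_of_injective fun a b hab => ?_)))
    · rintro _ ⟨a, rfl⟩
      exact h a
    · simpa using hab
  have hya : deriv (y - (a : K)) = 1 := by rw [map_sub, hy]; simp
  have hrow := B.connection_eval hya c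
  set v : Fin m → K := fun j => (c j).eval (y - a)
  have hli : LinearIndependent K (fun i : Fin m => (B.connection ^ (i : ℕ)) v) := by
    have h := Matrix.linearIndependent_rows_of_isUnit (A := M.map (eval (y - (a : K))))
      ((Matrix.isUnit_iff_isUnit_det _).2 (by rw [← hev]; exact ha.isUnit))
    convert h using 1
    ext i j
    rw [hrow]
    rfl
  rcases Nat.eq_zero_or_pos m with rfl | hm
  · exact ⟨v, Pi.basisFun K _, fun i => i.elim0⟩
  · have : Nonempty (Fin m) := ⟨⟨0, hm⟩⟩
    exact ⟨v, basisOfLinearIndependentOfCardEqFinrank hli (by simp), fun i => by simp⟩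

end CyclicVector

namespace DiffPolyRing

variable {K : Type} [Field K] {δ : Der K} {R : Type} [Ring R] {D : DiffPolyRing K δ R}
  {F : Type} [Field F] [Algebra F K]

lemma i_injective : Function.Injective D.i := fun a b h =>
  Finsupp.single_injective 0 (by rw [← D.coeff_i, h, D.coeff_i])

lemma not_finiteDimensional_Rlt {m : ℕ} (hm : 0 < m) (hK : ¬FiniteDimensional F K) :
    ¬FiniteDimensional F (D.Rlt m) := fun h => by
  let L : K →ₗ[F] D.Rlt m :=
    { toFun := fun a => ⟨D.i a, D.i_mem hm a⟩
      map_add' := fun a b => Subtype.ext (map_add D.i a b)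
      map_smul' := fun c a => Subtype.ext <| by
        rw [RingHom.id_apply, smul_coe, ← map_mul, ← Algebra.smul_def] }
  have hL : Function.Injective L := fun a b hab => D.i_injective (congrArg Subtype.val hab)
  exact hK (FiniteDimensional.of_injective L hL)

lemma RightNucPresents.not_subset {B : Type} [Ring B] [Algebra F B] [FiniteDimensional F B]
    {f : R} {m : ℕ} (h : D.RightNucPresents F f m B) (hf : D.deg f = (m : WithBot ℕ))
    (hm : 0 < m) (hK : ¬FiniteDimensional F K) : ¬D.SfSet m ⊆ D.nucr f m := fun hsub => by
  obtain ⟨φ, hadd, hmul, halg⟩ := h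
  have hsmul : ∀ (c : F) (x : B), (φ (c • x) : R) = D.i (algebraMap F K c) * φ x := fun c x => by
    rw [Algebra.smul_def, hmul, halg, pmul]
    exact modr_of_mem hf (D.deg_i_mul_lt _ (φ x).2.1)
  let L : K →ₗ[F] B :=
    { toFun := fun a => φ.symm ⟨D.i a, hsub (D.i_mem hm a)⟩
      map_add' := fun a b => φ.injective <| Subtype.ext <| by
        rw [hadd]; simp
      map_smul' := fun c a => φ.injective <| Subtype.ext <| by
        rw [RingHom.id_apply, hsmul]; simp [Algebra.smul_def] }
  have hL : Function.Injective L := fun a b hab =>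
    D.i_injective (congrArg Subtype.val (φ.symm.injective hab))
  exact hK (FiniteDimensional.of_injective L hL)

end DiffPolyRing

namespace Der

variable {K : Type} [Field K] {δ : Der K} {F : Type} [Field F] [Algebra F K]

open scoped Matrix in
/-- If `K` splits the division algebra `A` and carries a derivation with constants `F` and an
element of derivative `1`, then `A` is the right nucleus of a Petit algebra over `K`. -/
theorem HasConstants.exists_petit [CharZero K] (hδ : δ.HasConstants F) {y : K}
    (hy : δ.toFun y = 1) (halg : ∀ x : K, IsAlgebraic F x → ∃ c : F, algebraMap F K c = x)
    {A : Type} [DivisionRing A] [Algebra F A] [FiniteDimensional F A] {m : ℕ} (hm : 2 ≤ m)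
    (Φ : (K ⊗[F] A) ≃ₐ[K] Matrix (Fin m) (Fin m) K) :
    ∃ (R : Type) (_ : Ring R) (D : DiffPolyRing K δ R) (f : R),
      D.deg f = (m : WithBot ℕ) ∧ D.PetitUnital f m ∧ ¬FiniteDimensional F (D.Rlt m) ∧
      D.RightNucPresents F f m A ∧ D.nucl f m = Set.range D.i ∧ D.nucm f m = Set.range D.i := by
  have hK : ¬FiniteDimensional F K := fun h => by
    obtain ⟨c, hc⟩ := halg y (Algebra.IsAlgebraic.isAlgebraic y)
    rw [← hc, hδ.map_algebraMap] at hy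
    exact zero_ne_one hy
  have : Nonempty (Fin m) := ⟨⟨0, by omega⟩⟩
  obtain ⟨B, hB⟩ := hδ.exists_connection Φ
  let _ : Differential K := ⟨Derivation.mk' δ.addHom.toIntLinearMap fun a b =>
    (δ.leibniz' a b).trans (by rw [mul_comm (δ.toFun a)]; rfl)⟩
  obtain ⟨v, b, hb⟩ := B.exists_cyclic_vector (y := y) hy
  have hnabla : ∀ w, B.connection w = (fun j => δ.toFun (w j)) + w ᵥ* B := fun _ => rfl
  have hn : ∀ (a : K) (w : Fin m → K),
      B.connection (a • w) = δ.toFun a • w + a • B.connection w := fun a w => by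
    rw [hnabla, hnabla, Matrix.smul_vecMul, smul_add, ← add_assoc]
    congr 1
    ext j
    simp [δ.leibniz', add_comm]
  have hvec : ∀ (w : Fin m → K) (M : Matrix (Fin m) (Fin m) K),
      (fun j => δ.toFun ((w ᵥ* M) j)) = (fun j => δ.toFun (w j)) ᵥ* M + w ᵥ* M.map δ.toFun :=
    fun w M => by
      ext j
      have h : ∀ s : Fin m → K, δ.toFun (∑ k, s k) = ∑ k, δ.toFun (s k) := fun s =>
        map_sum δ.addHom s _
      simp [Matrix.vecMul, dotProduct, h, δ.leibniz', Finset.sum_add_distrib, add_comm]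
  have hcomm : ∀ M : Matrix (Fin m) (Fin m) K,
      (∀ w, B.connection w ᵥ* M = B.connection (w ᵥ* M)) ↔ M.map δ.toFun = B * M - M * B :=
    fun M => by
      have h : ∀ w, B.connection w ᵥ* M = B.connection (w ᵥ* M) ↔
          w ᵥ* (B * M - M * B) = w ᵥ* M.map δ.toFun := fun w => by
        rw [hnabla, hnabla, hvec, Matrix.add_vecMul, Matrix.vecMul_vecMul, Matrix.vecMul_vecMul,
          add_assoc, add_left_cancel_iff, ← sub_eq_iff_eq_add, Matrix.vecMul_sub]
      simp only [h]
      refine ⟨fun hw => ?_, fun hw w => by rw [hw]⟩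
      ext i j
      have := congrFun (hw (Pi.single i 1)) j
      simpa using this.symm
  let a : A →+ ((Fin m → K) →ₗ[K] (Fin m → K)) :=
    { toFun := fun d => (Φ (1 ⊗ₜ d)).vecMulLinear
      map_zero' := by ext; simp
      map_add' := fun d e => LinearMap.ext fun w => by
        simp [TensorProduct.tmul_add] }
  have ha : ∀ d w, a d w = w ᵥ* Φ (1 ⊗ₜ d) := fun _ _ => rfl
  have hvecinj : ∀ {M N : Matrix (Fin m) (Fin m) K}, (∀ w, w ᵥ* M = w ᵥ* N) → M = N :=
    fun {M N} h => by
      ext i j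
      simpa using congrFun (h (Pi.single i 1)) j
  obtain ⟨f, hf, hf0⟩ := DiffPolyRing.exists_annihilator (D := δ.polyRing) b hb
  have hnuc : δ.polyRing.RightNucPresents F f m A := by
    refine DiffPolyRing.rightNucPresents b hb hn hm hf hf0 a (fun x y w => ?_) (fun c w => ?_)
      (fun d e hde => ?_) (fun d w => ?_) (fun T hT => ?_)
    · rw [ha, ha, ha, Matrix.vecMul_vecMul, ← map_mul, Algebra.TensorProduct.tmul_mul_tmul,
        one_mul]
    · have h : (1 : K) ⊗ₜ[F] algebraMap F A c = algebraMap K (K ⊗[F] A) (algebraMap F K c) := by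
        rw [Algebra.TensorProduct.algebraMap_apply, ← Algebra.TensorProduct.tmul_one_eq_one_tmul]
        rfl
      rw [ha, h, AlgEquiv.commutes, Matrix.algebraMap_eq_diagonal]
      ext j
      simp [Matrix.vecMul_diagonal, mul_comm]
    · have h1 : Φ (1 ⊗ₜ d) = Φ (1 ⊗ₜ e) := hvecinj fun w => by
        rw [← ha, ← ha, hde]
      exact Algebra.TensorProduct.includeRight_injective (algebraMap F K).injective
        (Φ.injective h1)
    · exact (hcomm _).2 ((hB _).2 ⟨d, rfl⟩) w
    · have hTM : ∀ w, T w = w ᵥ* (LinearMap.toMatrix' T)ᵀ := fun w => by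
        rw [Matrix.vecMul_transpose, LinearMap.toMatrix'_mulVec]
      obtain ⟨d, hd⟩ := (hB _).1 ((hcomm (LinearMap.toMatrix' T)ᵀ).1 fun w => by
        rw [← hTM, ← hTM, hT])
      exact ⟨d, LinearMap.ext fun w => by rw [ha, hd, hTM]⟩
  have hne := hnuc.not_subset hf (by omega) hK
  exact ⟨_, _, δ.polyRing, f, hf, DiffPolyRing.petitUnital hf (by omega),
    DiffPolyRing.not_finiteDimensional_Rlt (by omega) hK, hnuc, DiffPolyRing.nucl_eq hf hm hne,
    DiffPolyRing.nucm_eq hf hm hne⟩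

end Der

section CentralSimple

variable {F A : Type} [Field F] [DivisionRing A] [Algebra F A]

/-- Scalar extension of a central division algebra is simple. -/
theorem isSimpleRing_tensorProduct [Algebra.IsCentral F A] (L : Type) [Field L] [Algebra F L] :
    IsSimpleRing (L ⊗[F] A) := by
  classical
  refine .of_eq_bot_or_eq_top fun I => or_iff_not_imp_left.mpr fun hI => ?_
  let b := Module.Basis.ofVectorSpace F L
  let e := TensorProduct.equivFinsuppOfBasisLeft (N := A) b
  have e_mul_right (x : L ⊗[F] A) (d : A) (i) : e (x * 1 ⊗ₜ d) i = e x i * d := by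
    induction x <;> simp_all [e, add_mul]
  have e_mul_left (x : L ⊗[F] A) (d : A) (i) : e (1 ⊗ₜ d * x) i = d * e x i := by
    induction x <;> simp_all [e, mul_add]
  have hne : ∃ n : ℕ, ∃ x ∈ I, x ≠ 0 ∧ (e x).support.card = n := by
    obtain ⟨x, hx, hx0⟩ := SetLike.exists_of_lt (bot_lt_iff_ne_bot.mpr hI)
    exact ⟨_, x, hx, by simpa using hx0, rfl⟩
  obtain ⟨x, hxI, hx0, hcard⟩ := Nat.find_spec hne
  have hmin {z : L ⊗[F] A} (hz : z ∈ I) (hlt : (e z).support ⊂ (e x).support) : z = 0 := by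
    by_contra hz0
    exact Nat.find_min hne (hcard ▸ Finset.card_lt_card hlt) ⟨z, hz, hz0, rfl⟩
  obtain ⟨i, hi⟩ : ∃ i, e x i ≠ 0 := by
    by_contra! h
    exact hx0 (e.injective (by ext j; simp [h]))
  obtain ⟨y, hyx⟩ : ∃ y, y = x * 1 ⊗ₜ[F] (e x i)⁻¹ := ⟨_, rfl⟩
  have hyI : y ∈ I := hyx ▸ I.mul_mem_right _ _ hxI
  have hy (j) : e y j = e x j * (e x i)⁻¹ := hyx ▸ e_mul_right _ _ _
  have hyi : e y i = 1 := by rw [hy, mul_inv_cancel₀ hi]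
  have hcomm (d : A) : 1 ⊗ₜ d * y - y * 1 ⊗ₜ d = 0 := by
    refine hmin (I.sub_mem (I.mul_mem_left _ _ hyI) (I.mul_mem_right _ _ hyI)) ?_
    refine Finset.ssubset_iff_subset_ne.mpr ⟨fun j hj => ?_, fun h => ?_⟩
    · simp only [Finsupp.mem_support_iff] at hj ⊢
      contrapose! hj
      rw [map_sub, Finsupp.sub_apply, e_mul_left, e_mul_right, hy, hj]
      simp
    · have := h.symm.subset (Finsupp.mem_support_iff.mpr hi)
      rw [Finsupp.mem_support_iff, map_sub, Finsupp.sub_apply, e_mul_left, e_mul_right, hyi] at this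
      simp at this
  have hcentral (j) : ∃ c : F, algebraMap F A c = e y j := by
    refine Algebra.mem_bot.mp (Algebra.IsCentral.out (Subalgebra.mem_center_iff.mpr fun d => ?_))
    have := congr(e $(hcomm d) j)
    rw [map_sub, Finsupp.sub_apply, e_mul_left, e_mul_right] at this
    simpa [sub_eq_zero] using this
  choose c hc using hcentral
  obtain ⟨l, hl⟩ : ∃ l : L, y = l ⊗ₜ 1 := by
    refine ⟨(e y).sum fun j _ => c j • b j, ?_⟩
    refine (e.symm_apply_apply y).symm.trans ?_
    rw [TensorProduct.equivFinsuppOfBasisLeft_symm_apply, Finsupp.sum, Finsupp.sum,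
      TensorProduct.sum_tmul]
    refine Finset.sum_congr rfl fun j _ => ?_
    rw [← hc, Algebra.algebraMap_eq_smul_one, TensorProduct.tmul_smul, TensorProduct.smul_tmul']
  have hl0 : l ≠ 0 := by
    rintro rfl
    rw [TensorProduct.zero_tmul] at hl
    simp [hl] at hyi
  rw [← I.one_mem_iff]
  have := I.mul_mem_left (l⁻¹ ⊗ₜ 1) _ hyI
  rwa [hl, Algebra.TensorProduct.tmul_mul_tmul, inv_mul_cancel₀ hl0, one_mul,
    ← Algebra.TensorProduct.one_def] at this

theorem exists_algEquiv_matrix_of_isAlgClosed_tensor [Algebra.IsCentral F A] {m : ℕ}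
    (hm : m ≠ 0) (hdeg : Module.finrank F A = m ^ 2) (L : Type) [Field L] [IsAlgClosed L]
    [Algebra F L] : Nonempty (L ⊗[F] A ≃ₐ[L] Matrix (Fin m) (Fin m) L) := by
  have := isSimpleRing_tensorProduct (A := A) (F := F) L
  have : FiniteDimensional F A := .of_finrank_pos (by rw [hdeg]; positivity)
  obtain ⟨n, _, ⟨e⟩⟩ := IsSimpleRing.exists_algEquiv_matrix_of_isAlgClosed L (L ⊗[F] A)
  have h := e.toLinearEquiv.finrank_eq
  rw [Module.finrank_baseChange, hdeg, Module.finrank_matrix] at h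
  have : m = n := by
    simp only [Fintype.card_fin, Module.finrank_self, mul_one, ← pow_two] at h
    exact Nat.pow_left_injective two_ne_zero h
  subst this
  exact ⟨e⟩

/-- An algebra map from a scalar extension of a central division algebra to a matrix algebra of
the same dimension is an isomorphism. -/
theorem bijective_of_finrank_eq [Algebra.IsCentral F A] [FiniteDimensional F A]
    {L B : Type} [Field L] [Algebra F L] [Ring B] [Nontrivial B] [Algebra L B]
    [FiniteDimensional L B] (φ : L ⊗[F] A →ₐ[L] B)
    (h : Module.finrank L B = Module.finrank F A) : Function.Bijective φ := by
  have := isSimpleRing_tensorProduct (A := A) (F := F) L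
  have hinj : Function.Injective φ := RingHom.injective (φ : L ⊗[F] A →+* B)
  refine ⟨hinj, ?_⟩
  exact (LinearMap.injective_iff_surjective_of_finrank_eq_finrank (f := φ.toLinearMap)
    (by rw [Module.finrank_baseChange, h])).mp hinj

end CentralSimple

section Eisenstein

open Polynomial

theorem Polynomial.Monic.exists_matrix_charpoly_eq {R : Type} [CommRing R] [Nontrivial R]
    {f : R[X]} (hf : f.Monic) {m : ℕ} (hm : f.natDegree = m) :
    ∃ T : Matrix (Fin m) (Fin m) R, T.charpoly = f := by
  obtain rfl : (AdjoinRoot.powerBasis' hf).dim = m := hm ▸ AdjoinRoot.powerBasis'_dim hf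
  refine ⟨Algebra.leftMulMatrix (AdjoinRoot.powerBasis' hf).basis
    (AdjoinRoot.powerBasis' hf).gen, ?_⟩
  rw [charpoly_leftMulMatrix]
  have hi := (AdjoinRoot.powerBasis' hf).isIntegral_gen
  refine eq_of_monic_of_dvd_of_natDegree_le hf (minpoly.monic hi) ?_ ?_
  · rw [← AdjoinRoot.mk_eq_zero, ← AdjoinRoot.aeval_eq]
    exact minpoly.aeval _ _
  · exact ((AdjoinRoot.powerBasis' hf).natDegree_minpoly.trans (AdjoinRoot.powerBasis'_dim hf)).le

theorem Polynomial.X_sub_C_sq_dvd {R : Type} [CommRing R] {f : R[X]} {a : R}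
    (h : f.eval a = 0) (h' : (derivative f).eval a = 0) : (X - C a) ^ 2 ∣ f := by
  by_cases hf : f = 0
  · simp [hf]
  · exact (le_rootMultiplicity_iff hf).mp
      (Nat.succ_le_of_lt ((one_lt_rootMultiplicity_iff_isRoot hf).mpr ⟨h, h'⟩))

/-- Hermite interpolation at an algebraic point: in characteristic zero, finitely many prescribed
values and derivatives are attained at a common point by polynomials over the base field. -/
theorem exists_common_hermite {F A ι : Type} [Field F] [CharZero F] [Field A] [Algebra F A]
    [Algebra.IsAlgebraic F A] [Finite ι] (a b : ι → A) :
    ∃ (α : A) (g : ι → F[X]), ∀ l, aeval α (g l) = a l ∧ aeval α (derivative (g l)) = b l := by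
  let E := IntermediateField.adjoin F (Set.range a ∪ Set.range b)
  have : FiniteDimensional F E := by
    have : Finite ↑(Set.range a ∪ Set.range b) :=
      ((Set.finite_range a).union (Set.finite_range b)).to_subtype
    exact IntermediateField.finiteDimensional_adjoin fun x _ => Algebra.IsIntegral.isIntegral x
  obtain ⟨α, hα⟩ := Field.exists_primitive_element F E
  have hsurj (x : E) : ∃ v : F[X], aeval α v = x := by
    have hx : x ∈ (IntermediateField.adjoin F {α}).toSubalgebra := by rw [hα]; trivial
    rw [IntermediateField.adjoin_simple_toSubalgebra_of_isAlgebraic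
      (Algebra.IsAlgebraic.isAlgebraic α), Algebra.adjoin_singleton_eq_range_aeval] at hx
    exact hx
  have hd := (Algebra.IsSeparable.isSeparable F α).aeval_derivative_ne_zero (minpoly.aeval F α)
  have hg (x y : E) : ∃ g : F[X], aeval α g = x ∧ aeval α (derivative g) = y := by
    obtain ⟨v, hv⟩ := hsurj x
    obtain ⟨w, hw⟩ := hsurj ((y - aeval α (derivative v)) / aeval α (derivative (minpoly F α)))
    refine ⟨v + minpoly F α * w, by simp [hv], ?_⟩
    simp [derivative_mul, hw, mul_div_cancel₀ _ hd]
  have ha (l) : a l ∈ E := IntermediateField.subset_adjoin F _ (.inl ⟨l, rfl⟩)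
  have hb (l) : b l ∈ E := IntermediateField.subset_adjoin F _ (.inr ⟨l, rfl⟩)
  choose g hg using fun l => hg ⟨a l, ha l⟩ ⟨b l, hb l⟩
  refine ⟨α, g, fun l => ?_⟩
  exact ⟨by simpa using congr(algebraMap E A $((hg l).1)),
    by simpa using congr(algebraMap E A $((hg l).2))⟩

/-- A spanning family of matrices over an algebraic extension `A` of `F` has a linear combination
with coefficients in `F[X]` whose characteristic polynomial is irreducible over `A[X]`. -/
theorem exists_irreducible_charpoly {F A ι : Type} [Field F] [CharZero F] [Field A] [Algebra F A]
    [Algebra.IsAlgebraic F A] [Fintype ι] {m : ℕ} (hm : 2 ≤ m)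
    (M : ι → Matrix (Fin m) (Fin m) A) (hM : Submodule.span A (Set.range M) = ⊤) :
    ∃ g : ι → F[X],
      Irreducible (∑ l, (g l).map (algebraMap F A) • (M l).map (C : A →+* A[X])).charpoly := by
  have hmon : (X ^ m - C X : A[X][X]).Monic := monic_X_pow_sub_C _ (by omega)
  obtain ⟨T, hT⟩ := hmon.exists_matrix_charpoly_eq (natDegree_X_pow_sub_C (n := m))
  obtain ⟨a, ha⟩ := (Submodule.mem_span_range_iff_exists_fun A).mp
    (hM ▸ Submodule.mem_top : T.map (eval 0) ∈ _)
  obtain ⟨b, hb⟩ := (Submodule.mem_span_range_iff_exists_fun A).mp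
    (hM ▸ Submodule.mem_top : T.map (fun p => eval 0 (derivative p)) ∈ _)
  obtain ⟨α, g, hg⟩ := exists_common_hermite (F := F) a b
  refine ⟨g, ?_⟩
  set U := ∑ l, (g l).map (algebraMap F A) • (M l).map (C : A →+* A[X]) with hU
  have hUij (i j) : U i j = ∑ l, (g l).map (algebraMap F A) * C (M l i j) := by
    simp [hU, Matrix.sum_apply]
  let P : Ideal A[X] := Ideal.span {X - C α}
  let τ : A[X] →+* A[X] := compRingHom (X - C α)
  have hUT : U.map (Ideal.Quotient.mk (P ^ 2)) = (T.map τ).map (Ideal.Quotient.mk (P ^ 2)) := by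
    ext i j
    rw [Matrix.map_apply, Matrix.map_apply, Matrix.map_apply, Ideal.Quotient.eq,
      Ideal.span_singleton_pow, Ideal.mem_span_singleton]
    have h0 := congr($ha i j)
    have h1 := congr($hb i j)
    simp only [Matrix.sum_apply, Matrix.smul_apply, smul_eq_mul, Matrix.map_apply] at h0 h1
    refine X_sub_C_sq_dvd ?_ ?_
    · simp [hUij, τ, eval_finsetSum, ← h0, (hg _).1, eval_comp]
    · simp [hUij, τ, eval_finsetSum, ← h1, (hg _).2, eval_comp, derivative_comp,
        derivative_mul, derivative_map]
  have hq : U.charpoly.map (Ideal.Quotient.mk (P ^ 2)) =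
      (X ^ m - C (X - C α)).map (Ideal.Quotient.mk (P ^ 2)) := by
    rw [← Matrix.charpoly_map, hUT, Matrix.charpoly_map, Matrix.charpoly_map, hT]
    simp [τ]
  have hcoeff (n : ℕ) : U.charpoly.coeff n - (X ^ m - C (X - C α)).coeff n ∈ P ^ 2 := by
    rw [← Ideal.Quotient.eq, ← coeff_map, ← coeff_map, hq]
  have hPX : X - C α ∈ P := Ideal.mem_span_singleton_self _
  have hP : P.IsPrime :=
    (Ideal.span_singleton_prime (X_sub_C_ne_zero α)).mpr (prime_X_sub_C α)
  have hdeg : U.charpoly.natDegree = m := by simp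
  refine irreducible_of_eisenstein_criterion hP ?_ (fun n hn => ?_) ?_ ?_
    U.charpoly_monic.isPrimitive
  · rw [U.charpoly_monic.leadingCoeff]
    exact fun h => hP.ne_top ((Ideal.eq_top_iff_one _).mpr h)
  · have hn' : n < m := by
      rw [← hdeg]; exact coe_lt_degree.mp hn
    have := Ideal.pow_le_self two_ne_zero (hcoeff n)
    refine (Submodule.sub_mem_iff_left _ ?_).mp this
    rw [coeff_sub, coeff_X_pow, if_neg hn'.ne, coeff_C, zero_sub]
    split_ifs
    · exact P.neg_mem hPX
    · simp
  · rw [← natDegree_pos_iff_degree_pos, hdeg]; omega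
  · intro h0
    have h := (Submodule.sub_mem_iff_right _ h0).mp (hcoeff 0)
    rw [coeff_sub, coeff_X_pow, if_neg (by omega), coeff_C_zero, zero_sub, neg_mem_iff,
      Ideal.span_singleton_pow, Ideal.mem_span_singleton] at h
    have := natDegree_le_of_dvd h (X_sub_C_ne_zero α)
    simp [natDegree_pow] at this

end Eisenstein

section Descent

open Polynomial

variable {F k L : Type} [Field F] [Field k] [Field L] [Algebra F k] [Algebra F L] [Algebra k L]
  [IsScalarTower F k L]

/-- A relation between scalar extensions descends to the base field. -/
theorem exists_monic_descent {B : Type} [Ring B] [Algebra F B] {u : k ⊗[F] B} {q : L[X]}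
    (hq : q.Monic)
    (hu : aeval (Algebra.TensorProduct.map (IsScalarTower.toAlgHom F k L) (AlgHom.id F B) u) q =
      0) :
    ∃ p : k[X], p.Monic ∧ p.natDegree = q.natDegree ∧ aeval u p = 0 := by
  obtain ⟨l, hl⟩ := (Algebra.linearMap k L).exists_leftInverse_of_injective
    (LinearMap.ker_eq_bot.mpr (algebraMap k L).injective)
  have hl1 : l 1 = 1 := by simpa using congr($hl 1)
  let ι := Algebra.TensorProduct.map (IsScalarTower.toAlgHom F k L) (AlgHom.id F B)
  let r : L ⊗[F] B →ₗ[F] k ⊗[F] B := TensorProduct.map (l.restrictScalars F) LinearMap.id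
  have hr (w : L) (x : k ⊗[F] B) : r (w • ι x) = l w • x := by
    induction x with
    | zero => simp
    | add x y hx hy => rw [map_add, smul_add, map_add, hx, hy, smul_add]
    | tmul a d =>
      simp only [ι, r, Algebra.TensorProduct.map_tmul, TensorProduct.smul_tmul',
        TensorProduct.map_tmul, IsScalarTower.coe_toAlgHom', smul_eq_mul, AlgHom.coe_id, id,
        LinearMap.id_apply, LinearMap.restrictScalars_apply]
      rw [mul_comm w, ← Algebra.smul_def, map_smul, smul_eq_mul, mul_comm]
  let p : k[X] := X ^ q.natDegree + ∑ i ∈ Finset.range q.natDegree, C (l (q.coeff i)) * X ^ i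
  have hdeg : (∑ i ∈ Finset.range q.natDegree, C (l (q.coeff i)) * X ^ i).degree <
      (q.natDegree : WithBot ℕ) :=
    (degree_sum_fin_lt fun i : Fin q.natDegree => l (q.coeff i)).trans_eq' (by
      rw [Finset.sum_range])
  refine ⟨p, monic_X_pow_add hdeg, ?_, ?_⟩
  · rw [natDegree_add_eq_left_of_degree_lt (by rwa [degree_X_pow]), natDegree_X_pow]
  · have h := congr(r $hu)
    rw [aeval_eq_sum_range, Finset.sum_range_succ, coeff_natDegree, hq.leadingCoeff, map_add,
      map_sum, map_zero] at h
    change ∑ i ∈ _, r (_ • ι u ^ _) + r ((1 : L) • ι u ^ _) = 0 at h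
    simp_rw [← map_pow, hr, hl1, one_smul] at h
    simpa [p, Algebra.smul_def, add_comm] using h

theorem exists_irreducible_descent {B : Type} [Ring B] [Algebra F B] {m : ℕ}
    (ρ : L ⊗[F] B →ₐ[L] Matrix (Fin m) (Fin m) L) (hρ : Function.Injective ρ) (hm : m ≠ 0)
    (u : k ⊗[F] B)
    (hirr : Irreducible (ρ (Algebra.TensorProduct.map (IsScalarTower.toAlgHom F k L)
      (AlgHom.id F B) u)).charpoly) :
    ∃ p : k[X], p.Monic ∧ p.natDegree = m ∧ aeval u p = 0 ∧
      Irreducible (p.map (algebraMap k L)) := by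
  have : Nonempty (Fin m) := ⟨0, Nat.pos_of_ne_zero hm⟩
  set ι := Algebra.TensorProduct.map (IsScalarTower.toAlgHom F k L) (AlgHom.id F B) with hι
  set q := (ρ (ι u)).charpoly with hq
  have hqm : q.Monic := Matrix.charpoly_monic _
  have hqd : q.natDegree = m := by simp [hq]
  have hq0 : aeval (ρ (ι u)) q = 0 := Matrix.aeval_self_charpoly _
  obtain ⟨p, hp, hpd, hpu⟩ := exists_monic_descent (u := u) hqm
    (hρ (by rw [← aeval_algHom_apply, map_zero]; exact hq0))
  refine ⟨p, hp, hpd.trans hqd, hpu, ?_⟩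
  have hpq : aeval (ρ (ι u)) (p.map (algebraMap k L)) = 0 := by
    have hιp := map_aeval_eq_aeval_map (φ := algebraMap k L) (ψ := (ι : k ⊗[F] B →+* L ⊗[F] B))
      (by ext a; simp [hι, Algebra.TensorProduct.algebraMap_apply]) p u
    rw [aeval_algHom_apply, ← AlgHom.coe_toRingHom ι, ← hιp, hpu, map_zero, map_zero]
  have hdvd : q ∣ p.map (algebraMap k L) := by
    rw [minpoly.eq_of_irreducible_of_monic hirr hq0 hqm]
    exact minpoly.dvd _ _ hpq
  rwa [eq_of_monic_of_dvd_of_natDegree_le hqm (hp.map _) hdvd (by simp [hpd])]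

/-- Algebraic elements of `k[X]/(p)` are constant if `p` stays irreducible over a field containing
an algebraic closure of the constants. -/
theorem AdjoinRoot.mem_range_of_isAlgebraic {A : Type} [Field A] [IsAlgClosed A] [Algebra F A]
    [Algebra A L] [IsScalarTower F A L] {p : k[X]} (hp : p.Monic)
    (hpL : Irreducible (p.map (algebraMap k L)))
    (hk : ∀ x : k, IsAlgebraic F x → ∃ c : F, algebraMap F k c = x)
    (x : AdjoinRoot p) (hx : IsAlgebraic F x) : ∃ c : F, algebraMap F (AdjoinRoot p) c = x := by
  have := Fact.mk hpL
  have hpos : 0 < p.degree := degree_map p (algebraMap k L) ▸ degree_pos_of_irreducible hpL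
  have hof : Function.Injective (AdjoinRoot.of p) :=
    AdjoinRoot.of.injective_of_degree_ne_zero hpos.ne'
  obtain ⟨g, hgp, rfl⟩ : ∃ g : k[X], g.degree < p.degree ∧ AdjoinRoot.mk p g = x :=
    ⟨AdjoinRoot.modByMonicHom hp x, by
      obtain ⟨g, rfl⟩ := AdjoinRoot.mk_surjective x
      rw [AdjoinRoot.modByMonicHom_mk]
      exact degree_modByMonic_lt _ hp, AdjoinRoot.mk_leftInverse hp x⟩
  let j := AdjoinRoot.mapAlgHom (IsScalarTower.toAlgHom F k L) p (p.map (algebraMap k L)) dvd_rfl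
  have hjx : IsIntegral A (j (AdjoinRoot.mk p g)) := (hx.isIntegral.map j).tower_top
  obtain ⟨e, he⟩ := minpoly.mem_range_of_degree_eq_one A _
    (IsAlgClosed.degree_eq_one_of_irreducible A (minpoly.irreducible hjx))
  have hj : j (AdjoinRoot.mk p g) = AdjoinRoot.mk _ (g.map (algebraMap k L)) := by
    change AdjoinRoot.map (algebraMap k L) p _ dvd_rfl _ = _
    rw [AdjoinRoot.map, AdjoinRoot.lift_mk, ← AdjoinRoot.aeval_eq,
      aeval_def, eval₂_map]
    rfl
  have hC : g.map (algebraMap k L) = C (algebraMap A L e) := by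
    rw [← sub_eq_zero]
    refine eq_zero_of_dvd_of_degree_lt (p := p.map (algebraMap k L)) ?_ ?_
    · rw [← AdjoinRoot.mk_eq_zero, map_sub, ← hj, ← he, sub_eq_zero, AdjoinRoot.mk_C]
      rfl
    · refine (degree_sub_le _ _).trans_lt (max_lt ?_ (degree_C_le.trans_lt ?_))
      · rwa [degree_map, degree_map]
      · rwa [degree_map]
  have hg : g = C (g.coeff 0) := by
    refine eq_C_of_natDegree_eq_zero ?_
    rw [← natDegree_map (algebraMap k L), hC, natDegree_C]
  rw [hg, AdjoinRoot.mk_C] at hx ⊢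
  obtain ⟨c, hc⟩ := hk _ ((isAlgebraic_algebraMap_iff (A := AdjoinRoot p) hof).mp hx)
  exact ⟨c, by rw [← hc]; rfl⟩

end Descent

section Splitting

open Polynomial

variable {F k A : Type} [Field F] [Field k] [Algebra F k] [DivisionRing A] [Algebra F A]

/-- A central division algebra of degree `m` is split by `k[X]/(p)` whenever `p` is an irreducible
polynomial of degree `m` having a root in its scalar extension to `k`. -/
theorem AdjoinRoot.nonempty_algEquiv_matrix [Algebra.IsCentral F A] {m : ℕ} (hm : m ≠ 0)
    (hdeg : Module.finrank F A = m ^ 2) {p : k[X]} [Fact (Irreducible p)] (hpd : p.natDegree = m)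
    {u : k ⊗[F] A} (hu : aeval u p = 0) :
    Nonempty (AdjoinRoot p ⊗[F] A ≃ₐ[AdjoinRoot p] Matrix (Fin m) (Fin m) (AdjoinRoot p)) := by
  have : FiniteDimensional F A := .of_finrank_pos (by rw [hdeg]; positivity)
  have hp0 : p ≠ 0 := (Fact.out : Irreducible p).ne_zero
  let f : k[X] →ₐ[k] Module.End k (k ⊗[F] A) := aeval (LinearMap.mulRight k u)
  have hf (r : k[X]) (x : k ⊗[F] A) : f r x = x * aeval u r := by
    unfold f
    induction r using Polynomial.induction_on generalizing x with
    | C a => simp [Algebra.algebraMap_eq_smul_one]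
    | add r s hr hs => simp [hr, hs, mul_add]
    | monomial n a h =>
      rw [pow_succ, ← mul_assoc, mul_comm, map_mul, Module.End.mul_apply, aeval_X, h,
        LinearMap.mulRight_apply, mul_assoc, mul_comm X, map_mul _ _ X, aeval_X]
  let Θ : AdjoinRoot p →+* Module.End k (k ⊗[F] A) :=
    Ideal.Quotient.lift (Ideal.span {p}) (f : k[X] →+* Module.End k (k ⊗[F] A)) (by
      intro r hr
      obtain ⟨s, rfl⟩ := Ideal.mem_span_singleton.mp hr
      refine LinearMap.ext fun x => (hf _ x).trans ?_
      rw [map_mul, hu, zero_mul, mul_zero, LinearMap.zero_apply])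
  let W := k ⊗[F] A
  let _ : Module (AdjoinRoot p) W := Module.compHom W Θ
  have smul_mk (r : k[X]) (x : W) : AdjoinRoot.mk p r • x = x * aeval u r := hf r x
  have : IsScalarTower k (AdjoinRoot p) W := .of_algebraMap_smul fun a x => by
    rw [AdjoinRoot.algebraMap_eq, ← AdjoinRoot.mk_C, smul_mk, aeval_C]
    exact (Algebra.commutes a x).symm.trans (Algebra.smul_def a x).symm
  have : IsScalarTower F (AdjoinRoot p) W := .of_algebraMap_smul fun a x => by
    rw [IsScalarTower.algebraMap_apply F k, algebraMap_smul, algebraMap_smul]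
  have : SMulCommClass (AdjoinRoot p) F W := IsScalarTower.to_smulCommClass'
  let l : A →ₐ[F] Module.End (AdjoinRoot p) W :=
    { toFun := fun d =>
        { toFun := fun x => 1 ⊗ₜ d * x
          map_add' := fun x y => mul_add _ _ _
          map_smul' := fun c x => by
            obtain ⟨r, rfl⟩ := AdjoinRoot.mk_surjective c
            rw [smul_mk, RingHom.id_apply, smul_mk, mul_assoc] }
      map_one' := by ext x; exact one_mul x
      map_mul' := fun d e => by
        ext x
        change 1 ⊗ₜ (d * e) * x = 1 ⊗ₜ d * (1 ⊗ₜ e * x)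
        rw [← mul_assoc, Algebra.TensorProduct.tmul_mul_tmul, one_mul]
      map_zero' := by ext x; change 1 ⊗ₜ 0 * x = 0; simp
      map_add' := fun d e => by
        ext x
        change 1 ⊗ₜ (d + e) * x = 1 ⊗ₜ d * x + 1 ⊗ₜ e * x
        rw [TensorProduct.tmul_add, add_mul]
      commutes' := fun c => by
        ext x
        change 1 ⊗ₜ algebraMap F A c * x = c • x
        rw [Algebra.algebraMap_eq_smul_one, TensorProduct.tmul_smul,
          ← Algebra.TensorProduct.one_def,
          smul_mul_assoc, one_mul] }
  let φ := Algebra.TensorProduct.lift (Algebra.ofId (AdjoinRoot p) (Module.End (AdjoinRoot p) W)) l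
    fun c d => Algebra.commutes c _
  have hk : Module.finrank k (AdjoinRoot p) = m := by
    rw [(AdjoinRoot.powerBasis hp0).finrank, AdjoinRoot.powerBasis_dim, hpd]
  have hW : Module.finrank (AdjoinRoot p) W = m := by
    have := Module.finrank_mul_finrank k (AdjoinRoot p) W
    rw [hk, Module.finrank_baseChange, hdeg, pow_two] at this
    exact Nat.eq_of_mul_eq_mul_left (Nat.pos_of_ne_zero hm) this
  have : FiniteDimensional (AdjoinRoot p) W := .of_finrank_pos (by rw [hW]; positivity)
  have hφ := bijective_of_finrank_eq φ (by
    rw [Module.finrank_linearMap, hW, hdeg, pow_two])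
  exact ⟨(AlgEquiv.ofBijective φ hφ).trans (algEquivMatrix (Module.finBasisOfFinrankEq _ W hW))⟩

end Splitting

section DerivationExtension

open Polynomial

variable {F K : Type} [Field F] [Field K] [Algebra F K]

theorem exists_derivation_eq_one [Algebra F[X] K] [IsScalarTower F F[X] K]
    [Algebra.FormallyEtale F[X] K] :
    ∃ d : Derivation F K K, d (algebraMap F[X] K X) = 1 := by
  let e := KaehlerDifferential.tensorKaehlerEquivOfFormallyEtale F F[X] K
  let l := ((mkDerivation F (1 : K)).liftKaehlerDifferential.liftBaseChange K) ∘ₗ e.symm.toLinearMap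
  refine ⟨l.compDer (KaehlerDifferential.D F K), ?_⟩
  change l (KaehlerDifferential.D F K _) = 1
  simp only [l, e, LinearMap.comp_apply, LinearEquiv.coe_coe,
    KaehlerDifferential.tensorKaehlerEquivOfFormallyEtale_symm_D_algebraMap,
    LinearMap.liftBaseChange_tmul, Derivation.liftKaehlerDifferential_comp_D, mkDerivation_X,
    one_smul]

/-- A nonzero derivation of a function field in one variable over `F` with `F` algebraically closed
in `K` has field of constants `F`. -/
theorem Derivation.eq_zero_iff_of_trdeg_eq_one [CharZero F] (htr : Algebra.trdeg F K ≤ 1)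
    (halg : ∀ x : K, IsAlgebraic F x → ∃ c : F, algebraMap F K c = x) (d : Derivation F K K)
    (hd : d ≠ 0) (a : K) : d a = 0 ↔ ∃ c : F, algebraMap F K c = a := by
  refine ⟨fun ha => ?_, fun ⟨c, hc⟩ => by rw [← hc, d.map_algebraMap]⟩
  by_contra hna
  have htrans : Transcendental F a := fun h => hna (halg a h)
  let C : IntermediateField F K :=
    { carrier := {x | d x = 0}
      mul_mem' := fun {x y} (hx : d x = 0) (hy : d y = 0) => by simp [hx, hy]
      add_mem' := fun {x y} (hx : d x = 0) (hy : d y = 0) => by simp [hx, hy]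
      algebraMap_mem' := d.map_algebraMap
      inv_mem' := fun x (hx : d x = 0) => by simp [Derivation.leibniz_inv, hx] }
  have hbasis : IsTranscendenceBasis F (fun _ : Unit => a) :=
    ((algebraicIndependent_unique_type_iff).mpr htrans).isTranscendenceBasis_of_trdeg_le_of_finite
      (by simpa using htr)
  have hle : Algebra.adjoin F (Set.range fun _ : Unit => a) ≤ C.toSubalgebra :=
    Algebra.adjoin_le (by rintro _ ⟨_, rfl⟩; exact ha)
  have hC (x : K) : IsAlgebraic C x :=
    IsAlgebraic.tower_top_of_subalgebra_le hle (hbasis.isAlgebraic.isAlgebraic x)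
  let d₀ : K →ₗ[C] K :=
    { toFun := d
      map_add' := d.map_add
      map_smul' := fun c x => by
        have hc : d (c : K) = 0 := c.2
        change d ((c : K) * x) = (c : K) * d x
        simp [hc] }
  let d' : Derivation C K K := Derivation.mk' d₀ d.leibniz
  refine hd (Derivation.ext fun x => ?_)
  have h := d'.map_aeval (minpoly C x) x
  rw [minpoly.aeval, map_zero, smul_eq_mul, eq_comm, mul_eq_zero] at h
  exact h.resolve_left ((minpoly.irreducible (hC x).isIntegral).separable.aeval_derivative_ne_zero
    (minpoly.aeval C x))

theorem exists_der_hasConstants [CharZero F] [Algebra F[X] K] [IsScalarTower F F[X] K]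
    [Algebra.FormallyEtale F[X] K] [Algebra.IsAlgebraic F[X] K] [FaithfulSMul F[X] K]
    (halg : ∀ x : K, IsAlgebraic F x → ∃ c : F, algebraMap F K c = x) :
    ∃ δ : Der K, δ.HasConstants F ∧ ∃ y, δ.toFun y = 1 := by
  obtain ⟨d, hd⟩ := exists_derivation_eq_one (F := F) (K := K)
  have htr : Algebra.trdeg F K ≤ 1 := by
    rw [← trdeg_add_eq (R := F) (S := F[X]) (A := K), Polynomial.trdeg_of_isDomain, trdeg_eq_zero,
      add_zero]
  refine ⟨⟨d, d.map_add, fun a b => by simp [mul_comm]⟩, ?_, _, hd⟩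
  exact d.eq_zero_iff_of_trdeg_eq_one htr halg (by rintro rfl; simp at hd)

end DerivationExtension

section Assembly

open Polynomial

theorem exists_annihilating_monic_of_isFractionRing {F A k L B : Type} [Field F] [CharZero F]
    [Field A] [IsAlgClosed A]
    [Algebra F A] [Algebra.IsAlgebraic F A] [Field k] [Field L] [Algebra F[X] k]
    [Algebra A[X] L] [IsFractionRing A[X] L] [Algebra F k] [IsScalarTower F F[X] k] [Algebra A L]
    [IsScalarTower A A[X] L] [Algebra F L] [Algebra k L] [IsScalarTower F k L]
    [IsScalarTower F A L]
    (hcomm : ∀ q : F[X],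
      algebraMap k L (algebraMap F[X] k q) = algebraMap A[X] L (q.map (algebraMap F A)))
    [DivisionRing B] [Algebra F B] [FiniteDimensional F B] [Algebra.IsCentral F B] {m : ℕ}
    (hm : 2 ≤ m) (hdeg : Module.finrank F B = m ^ 2) :
    ∃ p : k[X], p.Monic ∧ p.natDegree = m ∧ Irreducible (p.map (algebraMap k L)) ∧
      ∃ u : k ⊗[F] B, aeval u p = 0 := by
  obtain ⟨Φ⟩ := exists_algEquiv_matrix_of_isAlgClosed_tensor (F := F) (A := B) (m := m) (by omega)
    hdeg A
  let b := Module.finBasis F B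
  let M (j) := Φ (1 ⊗ₜ b j)
  have hM : Submodule.span A (Set.range M) = ⊤ := by
    have h := ((Algebra.TensorProduct.basis A b).map Φ.toLinearEquiv).span_eq
    have hb : M = (Algebra.TensorProduct.basis A b).map Φ.toLinearEquiv := by
      ext1 j
      simp [M]
    rwa [hb]
  obtain ⟨g, hg⟩ := exists_irreducible_charpoly (F := F) hm M hM
  let φ : A →ₐ[F] L := IsScalarTower.toAlgHom F A L
  let ρ₀ : B →ₐ[F] Matrix (Fin m) (Fin m) L :=
    φ.mapMatrix.comp ((Φ.toAlgHom.restrictScalars F).comp Algebra.TensorProduct.includeRight)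
  let ρ : L ⊗[F] B →ₐ[L] Matrix (Fin m) (Fin m) L :=
    Algebra.TensorProduct.lift (Algebra.ofId L _) ρ₀ fun x y => Algebra.commutes x (ρ₀ y)
  have : NeZero m := ⟨by omega⟩
  have hρ : Function.Injective ρ := by
    have := isSimpleRing_tensorProduct (F := F) (A := B) L
    exact RingHom.injective ρ.toRingHom
  let u : k ⊗[F] B := ∑ j, algebraMap F[X] k (g j) ⊗ₜ b j
  have hu : ρ (Algebra.TensorProduct.map (IsScalarTower.toAlgHom F k L) (AlgHom.id F B) u) =
      (∑ l, (g l).map (algebraMap F A) • (M l).map (C : A →+* A[X])).map (algebraMap A[X] L) := by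
    have hρ_tmul (x : L) (y : B) : ρ (x ⊗ₜ y) = x • (Φ (1 ⊗ₜ y)).map φ := by
      rw [Algebra.smul_def]
      exact Algebra.TensorProduct.lift_tmul ..
    ext i j
    simp [u, hρ_tmul, M, φ, hcomm, Matrix.sum_apply, -algebraMap_smul,
      IsScalarTower.algebraMap_apply A A[X] L]
  have hirr := (Matrix.charpoly_monic _).irreducible_iff_irreducible_map_fraction_map (K := L)
    |>.mp hg
  rw [← Matrix.charpoly_map] at hirr
  obtain ⟨p, hp, hpd, hpu, hpi⟩ := exists_irreducible_descent ρ hρ (by omega) u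
    (by rw [hu]; exact hirr)
  exact ⟨p, hp, hpd, hpi, u, hpu⟩

theorem exists_splitting_field (F B : Type) [Field F] [CharZero F] [DivisionRing B] [Algebra F B]
    [FiniteDimensional F B] [Algebra.IsCentral F B] {m : ℕ} (hm : 2 ≤ m)
    (hdeg : Module.finrank F B = m ^ 2) :
    ∃ (K : Type) (_ : Field K) (_ : Algebra F K),
      (∀ x : K, IsAlgebraic F x → ∃ c : F, algebraMap F K c = x) ∧
      Nonempty ((K ⊗[F] B) ≃ₐ[K] Matrix (Fin m) (Fin m) K) ∧
      ∃ δ : Der K, δ.HasConstants F ∧ ∃ y, δ.toFun y = 1 := by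
  let A := AlgebraicClosure F
  let k := RatFunc F
  let L := RatFunc A
  have hinj : Function.Injective ((algebraMap A[X] L).comp (mapRingHom (algebraMap F A))) :=
    (IsFractionRing.injective A[X] L).comp (map_injective _ (algebraMap F A).injective)
  let : Algebra k L := (IsFractionRing.lift hinj : k →+* L).toAlgebra
  have hcomm (q : F[X]) :
      algebraMap k L (algebraMap F[X] k q) = algebraMap A[X] L (q.map (algebraMap F A)) :=
    IsFractionRing.lift_algebraMap hinj q
  have hFL : (algebraMap F L) = (algebraMap A L).comp (algebraMap F A) :=
    IsScalarTower.algebraMap_eq F A L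
  have : IsScalarTower F k L := .of_algebraMap_eq fun x => by
    rw [IsScalarTower.algebraMap_apply F F[X] k, hcomm, Polynomial.algebraMap_apply,
      hFL, IsScalarTower.algebraMap_eq A A[X] L]
    simp
  obtain ⟨p, hp, hpd, hpi, u, hpu⟩ := exists_annihilating_monic_of_isFractionRing hcomm hm hdeg
  have : Fact (Irreducible p) := ⟨hp.irreducible_of_irreducible_map _ _ hpi⟩
  have hk (x : k) (hx : IsAlgebraic F x) : ∃ c, algebraMap F k c = x := by
    by_contra h
    refine RatFunc.transcendental_of_ne_C x (fun ⟨c, hc⟩ => h ⟨c, ?_⟩) hx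
    rw [hc, RatFunc.algebraMap_eq_C]
  let K := AdjoinRoot p
  have : FiniteDimensional k K := (AdjoinRoot.powerBasis hp.ne_zero).finite
  have halg := AdjoinRoot.mem_range_of_isAlgebraic (A := A) hp hpi hk
  refine ⟨K, inferInstance, inferInstance, halg,
    AdjoinRoot.nonempty_algEquiv_matrix (by omega) hdeg hpd hpu, ?_⟩
  have : CharZero k := charZero_of_injective_algebraMap (algebraMap F k).injective
  have : Algebra.FormallyEtale F[X] k := .of_isLocalization (nonZeroDivisors F[X])
  have : Algebra.FormallyEtale k K := .of_isSeparable k K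
  have : Algebra.FormallyEtale F[X] K := .comp F[X] k K
  have : FaithfulSMul F[X] K := (faithfulSMul_iff_algebraMap_injective _ _).mpr <| by
    rw [IsScalarTower.algebraMap_eq F[X] k K]
    exact (algebraMap k K).injective.comp (IsFractionRing.injective F[X] k)
  have : Algebra.IsAlgebraic F[X] K :=
    (IsFractionRing.comap_isAlgebraic_iff (A := F[X]) (K := k) (C := K)).mpr inferInstance
  exact exists_der_hasConstants halg

end Assembly

/-- For every central division algebra `Dv` of degree `m ≥ 2` over a field
`F` of characteristic zero there exist a field extension `K/F` in which `F` is algebraically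
closed and which splits `Dv`, a derivation `δ` on `K` with field of constants `F` and
`f ∈ K[t;δ]` of degree `m` such that the Petit algebra `S_f` is an infinite-dimensional
unital nonassociative `F`-algebra with right nucleus isomorphic to `Dv` and left and middle
nuclei equal to `K`. -/
theorem statement_1 (F Dv : Type) [Field F] [CharZero F] [DivisionRing Dv] [Algebra F Dv]
    (m : ℕ) (hm : 2 ≤ m) (hcentral : Algebra.IsCentral F Dv)
    (hdeg : Module.finrank F Dv = m ^ 2) :
    ∃ (K : Type) (_ : Field K) (_ : Algebra F K),
      (∀ x : K, IsAlgebraic F x → ∃ c : F, algebraMap F K c = x) ∧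
      Nonempty ((K ⊗[F] Dv) ≃ₐ[K] Matrix (Fin m) (Fin m) K) ∧
      ∃ δ : Der K, δ.HasConstants F ∧
        ∃ (R : Type) (_ : Ring R) (D : DiffPolyRing K δ R) (f : R),
          D.deg f = (m : WithBot ℕ) ∧
          D.PetitUnital f m ∧
          ¬FiniteDimensional F (D.Rlt m) ∧
          D.RightNucPresents F f m Dv ∧
          D.nucl f m = Set.range D.i ∧
          D.nucm f m = Set.range D.i := by
  have : FiniteDimensional F Dv := .of_finrank_pos (by rw [hdeg]; positivity)
  obtain ⟨K, hK, hFK, halg, ⟨Φ⟩, δ, hδ, y, hy⟩ := exists_splitting_field F Dv hm hdeg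
  have : CharZero K := charZero_of_injective_algebraMap (algebraMap F K).injective
  exact ⟨K, hK, hFK, halg, ⟨Φ⟩, δ, hδ, hδ.exists_petit hy halg hm Φ⟩
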